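/- arXiv:1304.3321 — 5 statements merged into one kernel-verified Lean document; each statement's English description precedes it below -/
import Mathlib

section
/- Let p > 3 be a prime, q = p^r, and let c, d ∈ F_q with c ≠ 0, d ≠ 0 and d(4c³ + 27d) ≠ 0 (so that y² = x³ + cx² + d defines an elliptic curve over F_q). Let N = #{(x, y) ∈ F_q × F_q : y² = x³ + cx² + d}. Then, as an identity in ℂ, q − N = −φ(d) − (φ(d)/(q−1)) · Σ_{l=0}^{q−2} (G_{−2l} · G_{−2l} · G_{3l} / G_{−l}) · T^l(4d/c³). (This is the Gauss-sum form, equation (3.13), of Theorem 3.4: the left-hand side q − N is the trace of Frobenius a_q of the elliptic curve y² = x³ + cx² + d.) -/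
open Finset

section aux
variable {F : Type} [Field F] [Fintype F] [DecidableEq F]

lemma aux_sum_units (f : F → ℂ) : ∑ x : F, f x = f 0 + ∑ u : Fˣ, f u := by
  rw [← Finset.add_sum_erase univ f (mem_univ 0)]
  congr 1
  symm
  refine Finset.sum_bij (fun u _ => (u : F)) ?_ ?_ ?_ ?_
  · intro u _; simp
  · intro a _ b _ h; exact Units.ext h
  · intro b hb
    exact ⟨Units.mk0 b (by simpa using hb), by simp, rfl⟩
  · intros; rfl

lemma aux_gauss_units (χ : MulChar F ℂ) (θ : AddChar F ℂ) :
    gaussSum χ θ = ∑ u : Fˣ, χ u * θ u := by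
  rw [gaussSum, aux_sum_units, MulChar.map_zero, zero_mul, zero_add]

lemma aux_gauss_ne (χ : MulChar F ℂ) (θ : AddChar F ℂ) (hθ : θ ≠ 1) : gaussSum χ θ ≠ 0 := by
  by_cases h : χ = 1
  · rw [h, gaussSum_one_left hθ]; norm_num
  · exact gaussSum_ne_zero_of_nontrivial (by simp) h (AddChar.IsPrimitive.of_ne_one hθ)

lemma aux_order (T : MulChar F ℂ) (hT : ∀ χ : MulChar F ℂ, ∃ n : ℤ, χ = T ^ n) :
    orderOf T = Fintype.card F - 1 := by
  rw [orderOf_eq_card_of_forall_mem_zpowers (g := T)]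
  · rw [MulChar.card_eq_card_units_of_hasEnoughRootsOfUnity, Nat.card_eq_fintype_card,
      Fintype.card_units]
  · intro χ
    obtain ⟨n, hn⟩ := hT χ
    exact ⟨n, hn.symm⟩

/-- the quadratic character -/
noncomputable def auxQ (F : Type) [Field F] [Fintype F] [DecidableEq F] : MulChar F ℂ :=
  (quadraticChar F).ringHomComp (Int.castRingHom ℂ)

lemma auxQ_apply (x : F) : auxQ F x = ((quadraticChar F x : ℤ) : ℂ) := rfl

lemma auxQ_sq (x : F) (hx : x ≠ 0) : auxQ F x * auxQ F x = 1 := by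
  rw [auxQ_apply]
  have := quadraticChar_sq_one hx
  rw [← Int.cast_mul, ← sq, this]; simp

lemma auxQ_mul_self : auxQ F * auxQ F = 1 := by
  ext u
  rw [MulChar.mul_apply, auxQ_sq _ u.ne_zero, MulChar.one_apply_coe]

lemma auxQ_ne_one (hF : ringChar F ≠ 2) : auxQ F ≠ 1 := by
  rw [auxQ]
  intro h
  apply quadraticChar_ne_one hF
  ext u
  have := congrArg (fun f : MulChar F ℂ => f u) h
  simp only [MulChar.one_apply_coe, MulChar.ringHomComp_apply] at this
  rw [MulChar.one_apply_coe]
  simpa using this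

lemma aux_two_tor (hodd : Odd (Fintype.card F)) (T : MulChar F ℂ)
    (hT : ∀ χ : MulChar F ℂ, ∃ n : ℤ, χ = T ^ n)
    (ψ : MulChar F ℂ) (h : ψ * ψ = 1) : ψ = 1 ∨ ψ = T ^ (((Fintype.card F - 1) / 2 : ℕ) : ℤ) := by
  obtain ⟨n, rfl⟩ := hT ψ
  have ho := aux_order T hT
  obtain ⟨k, hk⟩ := hodd
  have h1 : (Fintype.card F - 1) = 2 * k := by omega
  have h2 : (Fintype.card F - 1) / 2 = k := by omega
  rw [h2]
  rw [h1] at ho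
  rw [← zpow_add, ← orderOf_dvd_iff_zpow_eq_one, ho] at h
  obtain ⟨m, hm⟩ := h
  have hn : n = k * m := by push_cast at hm; linarith
  have hk2 : (T ^ (2 * k : ℤ)) = 1 := by
    rw [← orderOf_dvd_iff_zpow_eq_one, ho]; push_cast; exact dvd_rfl
  rcases Int.even_or_odd' m with ⟨j, rfl | rfl⟩
  · left
    rw [hn, show (k : ℤ) * (2 * j) = 2 * k * j by ring, zpow_mul, hk2, one_zpow]
  · right
    rw [hn, show (k : ℤ) * (2 * j + 1) = 2 * k * j + k by ring, zpow_add, zpow_mul, hk2, one_zpow,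
      one_mul]

lemma aux_orth (T : MulChar F ℂ) (hT : ∀ χ : MulChar F ℂ, ∃ n : ℤ, χ = T ^ n) (u : Fˣ) :
    ∑ l ∈ range (Fintype.card F - 1), T u ^ l =
      if u = 1 then ((Fintype.card F : ℂ) - 1) else 0 := by
  split_ifs with h
  · subst h
    have : 1 ≤ Fintype.card F := Fintype.card_pos
    simp [this]
  · have hne : T u ≠ 1 := by
      intro hu
      obtain ⟨χ, hχ⟩ := MulChar.exists_apply_ne_one_of_hasEnoughRootsOfUnity F ℂ
        (a := (u : F)) (by simpa using h)
      apply hχ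
      obtain ⟨n, rfl⟩ := hT χ
      have h1 : ∀ m : ℕ, (T ^ m) (u : F) = 1 := by
        intro m; rw [MulChar.pow_apply_coe, hu, one_pow]
      rcases n with m | m
      · simpa using h1 m
      · rw [zpow_negSucc, MulChar.inv_apply_eq_inv', h1, inv_one]
    have hpow : T u ^ (Fintype.card F - 1) = 1 := by
      rw [← MulChar.pow_apply_coe, ← aux_order T hT, pow_orderOf_eq_one, MulChar.one_apply_coe]
    rw [geom_sum_eq hne, hpow]; simp

lemma aux_sqrts (hF : ringChar F ≠ 2) (a : F) :
    (#{y : F | y ^ 2 = a} : ℂ) = auxQ F a + 1 := by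
  have := quadraticChar_card_sqrts hF a
  rw [auxQ_apply]
  have h2 : ({x : F | x ^ 2 = a} : Set F).toFinset = ({y : F | y ^ 2 = a} : Finset F) := by
    ext; simp
  rw [h2] at this
  exact_mod_cast this

lemma aux_sum_sq (hF : ringChar F ≠ 2) (g : F → ℂ) :
    ∑ w : F, g (w ^ 2) = ∑ a : F, (auxQ F a + 1) * g a := by
  rw [← Finset.sum_fiberwise univ (fun w : F => w ^ 2)]
  refine Finset.sum_congr rfl fun a _ => ?_
  rw [← aux_sqrts hF a, ← nsmul_eq_mul, ← Finset.sum_const]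
  refine Finset.sum_congr rfl fun w hw => ?_
  rw [(Finset.mem_filter.1 hw).2]

lemma aux_two_ne (hF : ringChar F ≠ 2) : (2 : F) ≠ 0 := Ring.two_ne_zero hF

lemma aux_jac (hF : ringChar F ≠ 2) (ψ : MulChar F ℂ) (h : ψ ≠ 1) :
    ψ 4 * jacobiSum ψ ψ = jacobiSum (auxQ F) ψ := by
  have h2 := aux_two_ne hF
  have e : ψ 4 * jacobiSum ψ ψ = ∑ w : F, ψ (1 - w ^ 2) := by
    rw [jacobiSum, Finset.mul_sum]
    refine Fintype.sum_bijective (fun x : F => 1 - 2 * x) ?_ _ _ ?_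
    · rw [← Finite.injective_iff_bijective]
      intro x y hxy
      simpa [h2] using hxy
    · intro x
      rw [← map_mul, ← map_mul]
      congr 1; ring
  rw [e, aux_sum_sq hF (fun a => ψ (1 - a)), jacobiSum]
  simp only [add_mul, one_mul, Finset.sum_add_distrib]
  have h0 : ∑ x : F, ψ (1 - x) = 0 :=
    (Equiv.sum_comp (Equiv.subLeft (1 : F)) (fun x => ψ x)).trans (MulChar.sum_eq_zero_of_ne_one h)
  rw [h0, add_zero]

lemma aux_HD (hF : ringChar F ≠ 2) (θ : AddChar F ℂ) (hθ : θ ≠ 1)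
    (htor : ∀ ψ : MulChar F ℂ, ψ * ψ = 1 → ψ = 1 ∨ ψ = auxQ F) (ψ : MulChar F ℂ) :
    gaussSum (ψ * ψ) θ * gaussSum (auxQ F) θ =
      ψ 4 * gaussSum ψ θ * gaussSum (auxQ F * ψ) θ := by
  have h2 := aux_two_ne hF
  have h4 : (4 : F) = 2 * 2 := by norm_num
  by_cases h : ψ * ψ = 1
  · rcases htor ψ h with rfl | rfl
    · have : (1 : MulChar F ℂ) 4 = 1 := MulChar.one_apply (by rw [h4]; simp [h2])
      simp [this]
    · rw [auxQ_mul_self, h4, map_mul, auxQ_sq _ h2]; ring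
  · have h1 : ψ ≠ 1 := by rintro rfl; simp at h
    have hq : auxQ F * ψ ≠ 1 := by
      intro hh
      apply h
      have : ψ = auxQ F := by
        rw [← one_mul ψ, ← auxQ_mul_self, mul_assoc, hh, mul_one]
      rw [this, auxQ_mul_self]
    have j1 := jacobiSum_mul_nontrivial h θ
    have j2 := jacobiSum_mul_nontrivial hq θ
    have j3 := aux_jac hF ψ h1
    have hg := aux_gauss_ne ψ θ hθ
    apply mul_right_cancel₀ hg
    linear_combination (-gaussSum (ψ * ψ) θ) * j2 + ψ 4 * gaussSum (auxQ F * ψ) θ * j1 -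
      gaussSum (auxQ F * ψ) θ * gaussSum (ψ * ψ) θ * j3

lemma aux_N (hF : ringChar F ≠ 2) (f : F → F) :
    (Fintype.card {xy : F × F // xy.2 ^ 2 = f xy.1} : ℂ) =
      Fintype.card F + ∑ x : F, auxQ F (f x) := by
  rw [Fintype.card_subtype, Finset.card_filter, Fintype.sum_prod_type]
  push_cast
  have : ∀ x : F, (∑ y : F, if y ^ 2 = f x then (1:ℂ) else 0) = auxQ F (f x) + 1 := by
    intro x
    rw [← aux_sqrts hF, Finset.card_filter]; push_cast; rfl
  simp only [this, Finset.sum_add_distrib]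
  simp [add_comm]

lemma aux_shift (hF : ringChar F ≠ 2) (θ : AddChar F ℂ) (a : F) :
    ∑ x : Fˣ, auxQ F x * θ (x * a) = auxQ F a * gaussSum (auxQ F) θ := by
  by_cases ha : a = 0
  · subst ha
    have := MulChar.sum_eq_zero_of_ne_one (auxQ_ne_one hF)
    rw [aux_sum_units, MulChar.map_zero, zero_add] at this
    simpa [MulChar.map_zero] using this
  · have := gaussSum_mulShift (auxQ F) θ (Units.mk0 a ha)
    rw [← this, ← mul_assoc, Units.val_mk0, auxQ_sq a ha, one_mul, aux_gauss_units]
    simp [AddChar.mulShift_apply, mul_comm]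

lemma aux_main (hF : ringChar F ≠ 2) (T : MulChar F ℂ)
    (hT : ∀ χ : MulChar F ℂ, ∃ n : ℤ, χ = T ^ n) (θ : AddChar F ℂ) (c d : Fˣ) :
    ∑ l ∈ range (Fintype.card F - 1),
      gaussSum (T ^ (-2 * (l : ℤ))) θ * gaussSum (T ^ (3 * (l : ℤ))) θ *
        gaussSum (auxQ F * T ^ (-(l : ℤ))) θ * (T ^ (l : ℤ)) (d / c ^ 3 : Fˣ) =
    ((Fintype.card F : ℂ) - 1) * (auxQ F d * gaussSum (auxQ F) θ *
      ∑ u : Fˣ, auxQ F (u ^ 3 + c * u ^ 2 + d)) := by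
  have hz : ∀ (n : ℤ) (u : Fˣ), (T ^ n) (u : F) = T (u ^ n : Fˣ) := by
    intro n u
    rcases n with m | m
    · simp [MulChar.pow_apply_coe]
    · rw [zpow_negSucc, zpow_negSucc, MulChar.inv_apply', ← Units.val_inv_eq_inv_val,
        MulChar.pow_apply_coe, ← map_pow, ← Units.val_pow_eq_pow_val, inv_pow]
  have step : ∀ l : ℕ, gaussSum (T ^ (-2 * (l : ℤ))) θ * gaussSum (T ^ (3 * (l : ℤ))) θ *
        gaussSum (auxQ F * T ^ (-(l : ℤ))) θ * (T ^ (l : ℤ)) (d / c ^ 3 : Fˣ) =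
      ∑ x : Fˣ, ∑ y : Fˣ, ∑ z : Fˣ,
        T (x ^ (-2 : ℤ) * y ^ 3 * z⁻¹ * (d / c ^ 3) : Fˣ) ^ l * (auxQ F z * θ (x + y + z)) := by
    intro l
    simp only [aux_gauss_units, Finset.sum_mul, MulChar.mul_apply, hz]
    refine Finset.sum_congr rfl fun x _ => ?_
    rw [Finset.mul_sum univ _ (T (x ^ (-2 * (l : ℤ)) : Fˣ) * θ x), Finset.sum_mul, Finset.sum_mul]
    refine Finset.sum_congr rfl fun y _ => ?_
    rw [Finset.mul_sum, Finset.sum_mul]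
    refine Finset.sum_congr rfl fun z _ => ?_
    rw [← map_pow, ← Units.val_pow_eq_pow_val, mul_pow, mul_pow, mul_pow, AddChar.map_add_eq_mul,
      AddChar.map_add_eq_mul, Units.val_mul, Units.val_mul, Units.val_mul, map_mul, map_mul,
      map_mul, zpow_mul, zpow_mul, zpow_neg, zpow_natCast, zpow_natCast, zpow_natCast,
      zpow_neg z, zpow_natCast z, inv_pow z]
    simp only [zpow_ofNat]
    ring
  simp only [step]
  rw [Finset.sum_comm]
  have e1 : ∀ x : Fˣ, (∑ l ∈ range (Fintype.card F - 1), ∑ y : Fˣ, ∑ z : Fˣ,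
        T (x ^ (-2 : ℤ) * y ^ 3 * z⁻¹ * (d / c ^ 3) : Fˣ) ^ l * (auxQ F z * θ (x + y + z))) =
      ∑ t : Fˣ, ((Fintype.card F : ℂ) - 1) * (auxQ F d * (auxQ F t * (auxQ F x *
        θ (x * (1 + c * t + d * t ^ 3))))) := by
    intro x
    rw [Finset.sum_comm]
    symm
    refine Fintype.sum_equiv (Equiv.mulLeft (c * x)) _ _ ?_
    intro t
    rw [Finset.sum_comm]
    simp only [← Finset.sum_mul, aux_orth T hT, Equiv.coe_mulLeft]
    rw [Finset.sum_eq_single (x * t ^ 3 * d)]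
    · rw [if_pos]
      · congr 1
        have ht := auxQ_sq (t : F) t.ne_zero
        push_cast
        rw [map_mul (auxQ F), map_mul (auxQ F), map_pow (auxQ F)]
        rw [show (x * (1 + c * t + d * t ^ 3) : F) = x + c * x * t + x * t ^ 3 * d by ring]
        linear_combination (-auxQ F x * auxQ F t * auxQ F d * 
          θ (x + c * x * t + x * t ^ 3 * d)) * ht
      · ext
        push_cast
        have := x.ne_zero
        have := t.ne_zero
        have := c.ne_zero
        have := d.ne_zero
        field_simp
    · intro z _ hne
      rw [if_neg, zero_mul]
      intro hh
      apply hne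
      have h3 := congrArg (fun u : Fˣ => (u : F)) hh
      push_cast at h3
      ext
      push_cast
      have := x.ne_zero
      have := t.ne_zero
      have := c.ne_zero
      have := d.ne_zero
      have := z.ne_zero
      field_simp at h3
      linear_combination -h3
    · simp
  simp only [e1]
  rw [Finset.sum_comm]
  simp only [← Finset.mul_sum]
  simp only [aux_shift hF]
  rw [mul_assoc (auxQ F d), Finset.mul_sum (s := univ) (a := gaussSum (auxQ F) θ)]
  congr 2
  refine Fintype.sum_equiv (Equiv.inv Fˣ) _ _ ?_
  intro t
  simp only [Equiv.inv_apply]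
  have h4 : auxQ F (t : F) ^ 4 = 1 := by
    have := auxQ_sq (t : F) t.ne_zero
    linear_combination (auxQ F t * auxQ F t + 1) * this
  have : (1 + c * t + d * t ^ 3 : F) = t ^ 3 * ((t⁻¹ : Fˣ) ^ 3 + c * (t⁻¹ : Fˣ) ^ 2 + d) := by
    have := t.ne_zero
    push_cast
    field_simp
  rw [this, map_mul, map_pow]
  linear_combination (gaussSum (auxQ F) θ * auxQ F ((t⁻¹ : Fˣ) ^ 3 + c * (t⁻¹ : Fˣ) ^ 2 + d)) * h4

end aux

/-- Gauss-sum form (equation (3.13)) of Theorem 3.4: for the elliptic curve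
`y² = x³ + cx² + d` over `F_q`, `q - N = -φ(d) - (φ(d)/(q-1)) Σ_l (G_{-2l}G_{-2l}G_{3l}/G_{-l}) T^l(4d/c³)`. -/
theorem trace_frobenius_gauss_sum_form_E1
    {p r : ℕ} (hp : p.Prime) (hp3 : 3 < p) (hr : 0 < r)
    {F : Type} [Field F] [Fintype F] [DecidableEq F]
    (hcard : Fintype.card F = p ^ r)
    (T : MulChar F ℂ) (hT : ∀ χ : MulChar F ℂ, ∃ n : ℤ, χ = T ^ n)
    (θ : AddChar F ℂ) (hθ : θ ≠ 1)
    (G : ℤ → ℂ) (hG : ∀ m : ℤ, G m = gaussSum (T ^ m) θ)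
    (φ : MulChar F ℂ) (hφ : φ = T ^ (((p ^ r - 1) / 2 : ℕ) : ℤ))
    (c d : F) (hc : c ≠ 0) (hd : d ≠ 0) (hΔ : d * (4 * c ^ 3 + 27 * d) ≠ 0)
    (N : ℕ)
    (hN : N = Fintype.card {xy : F × F // xy.2 ^ 2 = xy.1 ^ 3 + c * xy.1 ^ 2 + d}) :
    (p ^ r : ℂ) - (N : ℂ) =
      -φ d - φ d / ((p ^ r : ℂ) - 1) *
        ∑ l ∈ range (p ^ r - 1),
          G (-2 * (l : ℤ)) * G (-2 * (l : ℤ)) * G (3 * (l : ℤ)) / G (-(l : ℤ)) *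
            (T ^ (l : ℤ)) (4 * d / c ^ 3) := by
  have hodd : Odd (Fintype.card F) := by
    rw [hcard]; exact (hp.odd_of_ne_two (by omega)).pow
  have hF : ringChar F ≠ 2 := by
    intro h
    have := FiniteField.even_card_of_char_two h
    rw [Nat.odd_iff] at hodd
    omega
  have htor := aux_two_tor hodd T hT
  rw [hcard, ← hφ] at htor
  have hQ : φ = auxQ F := by
    rcases htor _ auxQ_mul_self with h | h
    · exact absurd h (auxQ_ne_one hF)
    · exact h.symm
  rw [hQ] at htor ⊢
  have hm := aux_main hF T hT θ (Units.mk0 c hc) (Units.mk0 d hd)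
  have hHD := aux_HD hF θ hθ htor
  have hq1 : ((p : ℂ) ^ r - 1) ≠ 0 := by
    have h1 : 1 < Fintype.card F := Fintype.one_lt_card
    rw [hcard] at h1
    rw [sub_ne_zero]
    exact_mod_cast h1.ne'
  have hgQ := aux_gauss_ne (auxQ F) θ hθ
  have h4 : (4 : F) ≠ 0 := by
    have h2 := aux_two_ne hF
    rw [show (4 : F) = 2 * 2 by norm_num]; simp [h2]
  have hsum : (∑ l ∈ range (p ^ r - 1),
          G (-2 * (l : ℤ)) * G (-2 * (l : ℤ)) * G (3 * (l : ℤ)) / G (-(l : ℤ)) *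
            (T ^ (l : ℤ)) (4 * d / c ^ 3)) * gaussSum (auxQ F) θ =
      ((Fintype.card F : ℂ) - 1) * (auxQ F d * gaussSum (auxQ F) θ *
      ∑ u : Fˣ, auxQ F ((u : F) ^ 3 + c * (u : F) ^ 2 + d)) := by
    simp only [Units.val_mk0] at hm
    rw [← hm, Finset.sum_mul, hcard]
    refine Finset.sum_congr rfl fun l _ => ?_
    have hd1 := hHD (T ^ (-(l : ℤ)))
    rw [← zpow_add, show -(l : ℤ) + -(l : ℤ) = -2 * l by ring] at hd1
    have hgl := aux_gauss_ne (T ^ (-(l : ℤ))) θ hθ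
    have hT4 : (T ^ (l : ℤ)) 4 * (T ^ (-(l : ℤ))) 4 = 1 := by
      rw [← MulChar.mul_apply, ← zpow_add, add_neg_cancel, zpow_zero]
      exact MulChar.one_apply (isUnit_iff_ne_zero.2 h4)
    simp only [hG]
    rw [mul_div_assoc (4 : F), map_mul]
    have hv : ((Units.mk0 d hd / Units.mk0 c hc ^ 3 : Fˣ) : F) = d / c ^ 3 := by
      push_cast; simp
    rw [hv]
    field_simp
    generalize gaussSum (T ^ (-2 * (l : ℤ))) θ = A at *
    generalize gaussSum (T ^ (-(l : ℤ))) θ = B at *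
    generalize gaussSum (T ^ (3 * (l : ℤ))) θ = C at *
    generalize gaussSum (auxQ F * T ^ (-(l : ℤ))) θ = D at *
    generalize (T ^ (l : ℤ)) (d / c ^ 3) = X at *
    linear_combination (A * C * X * (T ^ (l : ℤ)) 4) * hd1 + A * B * C * D * X * hT4
  have hsum2 := mul_right_cancel₀ hgQ (hsum.trans (show _ = (((p : ℂ) ^ r - 1) * (auxQ F d * 
      ∑ u : Fˣ, auxQ F ((u : F) ^ 3 + c * (u : F) ^ 2 + d))) * gaussSum (auxQ F) θ by
        rw [hcard]; push_cast; ring))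
  rw [hsum2, hN, aux_N hF (fun x => x ^ 3 + c * x ^ 2 + d), aux_sum_units, hcard]
  have hdd := auxQ_sq d hd
  push_cast
  simp only [ne_eq, OfNat.ofNat_ne_zero, not_false_eq_true, zero_pow, mul_zero, zero_add]
  generalize (∑ u : Fˣ, auxQ F ((u : F) ^ 3 + c * (u : F) ^ 2 + d)) = S
  field_simp
  linear_combination S * hdd
end

section
/- Let p > 3 be a prime and q = p^r. For all integers l and i with 1 ≤ l ≤ q−2 and 0 ≤ i ≤ r−1, the following identity of integers holds: ⌊−l·p^i/(q−1)⌋ − 2·⌊−2l·p^i/(q−1)⌋ − ⌊3l·p^i/(q−1)⌋ − 1 = −2·⌊⟨p^i/2⟩ − l·p^i/(q−1)⌋ − ⌊⟨−p^i/3⟩ + l·p^i/(q−1)⌋ − ⌊⟨−2p^i/3⟩ + l·p^i/(q−1)⌋. (Lemma 3.2 of the paper.) -/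
theorem aux_two (y : ℚ) : ⌊2 * y⌋ = ⌊y⌋ + ⌊1 / 2 + y⌋ := by
  have h1 := Int.floor_le y
  have h2 := Int.lt_floor_add_one y
  generalize ⌊y⌋ = a at *
  rcases lt_or_ge (y - a) (1 / 2) with h | h
  · rw [show ⌊2 * y⌋ = 2 * a by rw [Int.floor_eq_iff]; push_cast; constructor <;> linarith,
      show ⌊1 / 2 + y⌋ = a by rw [Int.floor_eq_iff]; constructor <;> linarith]; ring
  · rw [show ⌊2 * y⌋ = 2 * a + 1 by rw [Int.floor_eq_iff]; push_cast; constructor <;> linarith,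
      show ⌊1 / 2 + y⌋ = a + 1 by rw [Int.floor_eq_iff]; push_cast; constructor <;> linarith]; ring

theorem aux_three (y : ℚ) : ⌊3 * y⌋ = ⌊y⌋ + ⌊1 / 3 + y⌋ + ⌊2 / 3 + y⌋ := by
  have h1 := Int.floor_le y
  have h2 := Int.lt_floor_add_one y
  generalize ⌊y⌋ = a at *
  rcases lt_or_ge (y - a) (1 / 3) with h | h
  · rw [show ⌊3 * y⌋ = 3 * a by rw [Int.floor_eq_iff]; push_cast; constructor <;> linarith,
      show ⌊1 / 3 + y⌋ = a by rw [Int.floor_eq_iff]; constructor <;> linarith,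
      show ⌊2 / 3 + y⌋ = a by rw [Int.floor_eq_iff]; constructor <;> linarith]; ring
  rcases lt_or_ge (y - a) (2 / 3) with h' | h'
  · rw [show ⌊3 * y⌋ = 3 * a + 1 by rw [Int.floor_eq_iff]; push_cast; constructor <;> linarith,
      show ⌊1 / 3 + y⌋ = a by rw [Int.floor_eq_iff]; constructor <;> linarith,
      show ⌊2 / 3 + y⌋ = a + 1 by
        rw [Int.floor_eq_iff]; push_cast; constructor <;> linarith]; ring
  · rw [show ⌊3 * y⌋ = 3 * a + 2 by rw [Int.floor_eq_iff]; push_cast; constructor <;> linarith,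
      show ⌊1 / 3 + y⌋ = a + 1 by rw [Int.floor_eq_iff]; push_cast; constructor <;> linarith,
      show ⌊2 / 3 + y⌋ = a + 1 by
        rw [Int.floor_eq_iff]; push_cast; constructor <;> linarith]; ring

theorem aux_neg (y : ℚ) (h : ∀ n : ℤ, y ≠ n) : ⌊-y⌋ = -⌊y⌋ - 1 := by
  have h1 := lt_of_le_of_ne (Int.floor_le y) (h _).symm
  have h2 := Int.lt_floor_add_one y
  rw [Int.floor_eq_iff]; push_cast; constructor <;> linarith

theorem aux_fract (y c : ℚ) (z : ℤ) (h0 : 0 ≤ c) (h1 : c < 1) (h : y = z + c) :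
    Int.fract y = c := by
  rw [Int.fract_eq_iff]; exact ⟨h0, h1, z, by rw [h]; ring⟩

/-- Lemma 3.2 of the paper: a floor-function identity. Here `⟨x⟩` is the fractional part
`Int.fract x` of a rational number `x`. -/
theorem floor_identity_lemma32
    {p r : ℕ} (hp : p.Prime) (hp3 : 3 < p) (hr : 0 < r)
    (l i : ℕ) (hl1 : 1 ≤ l) (hl2 : l ≤ p ^ r - 2) (hi : i ≤ r - 1) :
    ⌊(-(l : ℚ) * (p : ℚ) ^ i / ((p : ℚ) ^ r - 1))⌋ -
        2 * ⌊(-(2 * (l : ℚ)) * (p : ℚ) ^ i / ((p : ℚ) ^ r - 1))⌋ -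
        ⌊(3 * (l : ℚ) * (p : ℚ) ^ i / ((p : ℚ) ^ r - 1))⌋ - 1 =
      -2 * ⌊Int.fract ((p : ℚ) ^ i / 2) - (l : ℚ) * (p : ℚ) ^ i / ((p : ℚ) ^ r - 1)⌋ -
        ⌊Int.fract (-(p : ℚ) ^ i / 3) + (l : ℚ) * (p : ℚ) ^ i / ((p : ℚ) ^ r - 1)⌋ -
        ⌊Int.fract (-(2 * (p : ℚ) ^ i) / 3) + (l : ℚ) * (p : ℚ) ^ i / ((p : ℚ) ^ r - 1)⌋ := by
  set x : ℚ := (l : ℚ) * (p : ℚ) ^ i / ((p : ℚ) ^ r - 1) with hx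
  have hq : 2 ≤ p ^ r := le_trans (by omega) (Nat.le_self_pow hr.ne' p)
  have hq' : ((p : ℚ) ^ r - 1) ≠ 0 := by
    have : (2 : ℚ) ≤ (p : ℚ) ^ r := by exact_mod_cast hq
    linarith
  have hnon : ∀ n : ℤ, x ≠ n := by
    intro n hn
    rw [hx, div_eq_iff hq'] at hn
    have hz : (l : ℤ) * (p : ℤ) ^ i = n * ((p : ℤ) ^ r - 1) := by exact_mod_cast hn
    have hdvd : ((p : ℤ) ^ r - 1) ∣ (l : ℤ) * (p : ℤ) ^ i := ⟨n, by rw [hz]; ring⟩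
    have hcop : IsCoprime ((p : ℤ) ^ r - 1) ((p : ℤ) ^ i) := by
      apply IsCoprime.pow_right
      refine ⟨-1, (p : ℤ) ^ (r - 1), ?_⟩
      rw [← pow_succ, Nat.sub_add_cancel hr]; ring
    have h2 := Int.le_of_dvd (by omega) (hcop.dvd_of_dvd_mul_right hdvd)
    have h3 : ((p ^ r : ℕ) : ℤ) = (p : ℤ) ^ r := by push_cast; rfl
    omega
  have hodd : p ^ i % 2 = 1 := by
    have : Odd p := hp.odd_of_ne_two (by omega)
    exact Nat.odd_iff.mp this.pow
  have hthree : p ^ i % 3 ≠ 0 := by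
    intro h
    have := (Nat.prime_dvd_prime_iff_eq Nat.prime_three hp).mp
      (Nat.prime_three.dvd_of_dvd_pow (Nat.dvd_of_mod_eq_zero h))
    omega
  have e1 : -(l : ℚ) * (p : ℚ) ^ i / ((p : ℚ) ^ r - 1) = -x := by rw [hx]; ring
  have e2 : -(2 * (l : ℚ)) * (p : ℚ) ^ i / ((p : ℚ) ^ r - 1) = 2 * (-x) := by rw [hx]; ring
  have e3 : 3 * (l : ℚ) * (p : ℚ) ^ i / ((p : ℚ) ^ r - 1) = 3 * x := by rw [hx]; ring
  rw [e1, e2, e3, aux_two, aux_three]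
  have hP : (p : ℚ) ^ i = ((p ^ i : ℕ) : ℚ) := by push_cast; rfl
  rw [hP]
  clear_value x
  generalize p ^ i = P at *
  have f1 : Int.fract ((P : ℚ) / 2) = 1 / 2 := by
    obtain ⟨k, hk⟩ : ∃ k, P = 2 * k + 1 := ⟨P / 2, by omega⟩
    apply aux_fract _ _ k (by norm_num) (by norm_num)
    rw [hk]; push_cast; ring
  have hn := aux_neg x hnon
  rw [f1, sub_eq_add_neg (1 / 2 : ℚ) x]
  rcases (show P % 3 = 1 ∨ P % 3 = 2 by omega) with h | h
  · obtain ⟨k, hk⟩ : ∃ k, P = 3 * k + 1 := ⟨P / 3, by omega⟩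
    have f2 : Int.fract (-(P : ℚ) / 3) = 2 / 3 := by
      apply aux_fract _ _ (-k - 1) (by norm_num) (by norm_num)
      rw [hk]; push_cast; ring
    have f3 : Int.fract (-(2 * (P : ℚ)) / 3) = 1 / 3 := by
      apply aux_fract _ _ (-2 * k - 1) (by norm_num) (by norm_num)
      rw [hk]; push_cast; ring
    rw [f2, f3, hn]; ring
  · obtain ⟨k, hk⟩ : ∃ k, P = 3 * k + 2 := ⟨P / 3, by omega⟩
    have f2 : Int.fract (-(P : ℚ) / 3) = 1 / 3 := by
      apply aux_fract _ _ (-k - 1) (by norm_num) (by norm_num)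
      rw [hk]; push_cast; ring
    have f3 : Int.fract (-(2 * (P : ℚ)) / 3) = 2 / 3 := by
      apply aux_fract _ _ (-2 * k - 2) (by norm_num) (by norm_num)
      rw [hk]; push_cast; ring
    rw [f2, f3, hn]; ring
end

section
/- Let p > 3 be a prime and q = p^r. For all integers l and i with 0 ≤ l ≤ q−2 and 0 ≤ i ≤ r−1, the following identity of integers holds: ⌊2l·p^i/(q−1)⌋ + 2·⌊−l·p^i/(q−1)⌋ − 2·⌊−2l·p^i/(q−1)⌋ − ⌊4l·p^i/(q−1)⌋ = −2·⌊⟨p^i/2⟩ − l·p^i/(q−1)⌋ − ⌊⟨−p^i/4⟩ + l·p^i/(q−1)⌋ − ⌊⟨−3p^i/4⟩ + l·p^i/(q−1)⌋. (Lemma 3.3 of the paper.) -/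
theorem floor_two_mul_aux (y : ℚ) : ⌊2 * y⌋ = ⌊y⌋ + ⌊y + 1 / 2⌋ := by
  have h1 := Int.floor_le y
  have h2 := Int.lt_floor_add_one y
  rcases lt_or_ge y (⌊y⌋ + 1 / 2) with h | h
  · have e : ⌊y + 1 / 2⌋ = ⌊y⌋ := by
      rw [Int.floor_eq_iff]; constructor <;> linarith
    rw [e, Int.floor_eq_iff]; push_cast; constructor <;> linarith
  · have e : ⌊y + 1 / 2⌋ = ⌊y⌋ + 1 := by
      rw [Int.floor_eq_iff]; push_cast; constructor <;> linarith
    rw [e, Int.floor_eq_iff]; push_cast; constructor <;> linarith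

theorem fract_aux (y f : ℚ) (z : ℤ) (h : y = z + f) (h0 : 0 ≤ f) (h1 : f < 1) :
    Int.fract y = f := by
  rw [Int.fract_eq_iff]
  exact ⟨h0, h1, z, by rw [h]; ring⟩

/-- Lemma 3.3 of the paper: a floor-function identity. Here `⟨x⟩` is the fractional part
`Int.fract x` of a rational number `x`. -/
theorem floor_identity_lemma33
    {p r : ℕ} (hp : p.Prime) (hp3 : 3 < p) (hr : 0 < r)
    (l i : ℕ) (hl2 : l ≤ p ^ r - 2) (hi : i ≤ r - 1) :
    ⌊(2 * (l : ℚ) * (p : ℚ) ^ i / ((p : ℚ) ^ r - 1))⌋ +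
        2 * ⌊(-(l : ℚ) * (p : ℚ) ^ i / ((p : ℚ) ^ r - 1))⌋ -
        2 * ⌊(-(2 * (l : ℚ)) * (p : ℚ) ^ i / ((p : ℚ) ^ r - 1))⌋ -
        ⌊(4 * (l : ℚ) * (p : ℚ) ^ i / ((p : ℚ) ^ r - 1))⌋ =
      -2 * ⌊Int.fract ((p : ℚ) ^ i / 2) - (l : ℚ) * (p : ℚ) ^ i / ((p : ℚ) ^ r - 1)⌋ -
        ⌊Int.fract (-(p : ℚ) ^ i / 4) + (l : ℚ) * (p : ℚ) ^ i / ((p : ℚ) ^ r - 1)⌋ -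
        ⌊Int.fract (-(3 * (p : ℚ) ^ i) / 4) + (l : ℚ) * (p : ℚ) ^ i / ((p : ℚ) ^ r - 1)⌋ := by
  have hodd : Odd (p ^ i) := (hp.odd_of_ne_two (by omega)).pow
  have hcast : ((p : ℚ) ^ i) = ((p ^ i : ℕ) : ℚ) := by push_cast; rfl
  set x : ℚ := (l : ℚ) * (p : ℚ) ^ i / ((p : ℚ) ^ r - 1) with hx
  have e1 : 2 * (l : ℚ) * (p : ℚ) ^ i / ((p : ℚ) ^ r - 1) = 2 * x := by rw [hx]; ring
  have e2 : -(l : ℚ) * (p : ℚ) ^ i / ((p : ℚ) ^ r - 1) = -x := by rw [hx]; ring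
  have e3 : -(2 * (l : ℚ)) * (p : ℚ) ^ i / ((p : ℚ) ^ r - 1) = 2 * (-x) := by rw [hx]; ring
  have e4 : 4 * (l : ℚ) * (p : ℚ) ^ i / ((p : ℚ) ^ r - 1) = 2 * (2 * x) := by rw [hx]; ring
  rw [e1, e2, e3, e4]
  clear_value x
  have f1 := floor_two_mul_aux x
  have f2 := floor_two_mul_aux (-x)
  have f3 := floor_two_mul_aux (2 * x)
  have f4 := floor_two_mul_aux (x + 1 / 4)
  rw [show 2 * (x + 1 / 4) = 2 * x + 1 / 2 by ring,
    show x + 1 / 4 + 1 / 2 = 3 / 4 + x by ring, add_comm x (1 / 4)] at f4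
  rw [neg_add_eq_sub] at f2
  rw [hcast]
  generalize p ^ i = n at hodd
  have hn : n % 4 = 1 ∨ n % 4 = 3 := by
    have := Nat.odd_iff.mp hodd
    omega
  have hd : (n : ℚ) = 4 * ((n / 4 : ℕ) : ℚ) + ((n % 4 : ℕ) : ℚ) := by
    exact_mod_cast (Nat.div_add_mod n 4).symm
  generalize n / 4 = k at hd
  rcases hn with h | h
  · rw [h] at hd
    rw [fract_aux ((n : ℚ) / 2) (1 / 2) (2 * k) (by rw [hd]; push_cast; ring)
        (by norm_num) (by norm_num),
      fract_aux (-(n : ℚ) / 4) (3 / 4) (-k - 1) (by rw [hd]; push_cast; ring)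
        (by norm_num) (by norm_num),
      fract_aux (-(3 * (n : ℚ)) / 4) (1 / 4) (-3 * k - 1) (by rw [hd]; push_cast; ring)
        (by norm_num) (by norm_num)]
    omega
  · rw [h] at hd
    rw [fract_aux ((n : ℚ) / 2) (1 / 2) (2 * k + 1) (by rw [hd]; push_cast; ring)
        (by norm_num) (by norm_num),
      fract_aux (-(n : ℚ) / 4) (1 / 4) (-k - 1) (by rw [hd]; push_cast; ring)
        (by norm_num) (by norm_num),
      fract_aux (-(3 * (n : ℚ)) / 4) (3 / 4) (-3 * k - 3) (by rw [hd]; push_cast; ring)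
        (by norm_num) (by norm_num)]
    omega
end

section
/- Let p be an odd prime and q = p^r. For every integer l, the Gauss sums satisfy G_{−l + (q−1)/2} · G_{−l} = G_{(q−1)/2} · G_{−2l} · T^l(4). Equivalently, for every multiplicative character ψ of F_q (here ψ = T^{−l}), G(φψ) · G(ψ) = G(φ) · G(ψ²) · ψ(4)^{−1}·ψ(4)·T^l(4), i.e. the Hasse–Davenport product relation for m = 2 in the form of equation (3.12) of the paper: G_{−l+(q−1)/2} = G_{(q−1)/2} · G_{−2l} · T^l(4) / G_{−l}. -/
lemma sq_one_cases {F : Type} [Field F] [Fintype F] [DecidableEq F] (h2 : ringChar F ≠ 2)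
    (ψ : MulChar F ℂ) (hs : ψ ^ 2 = 1) :
    ψ = 1 ∨ ψ = (quadraticChar F).ringHomComp (Int.castRingHom ℂ) := by
  have hval : ∀ c : F, c ≠ 0 → ψ c * ψ c = 1 := fun c hc => by
    rw [← sq, ← MulChar.pow_apply' _ two_ne_zero, hs]
    exact MulChar.one_apply (isUnit_iff_ne_zero.2 hc)
  have hsqr : ∀ a : F, a ≠ 0 → quadraticChar F a = 1 → ψ a = 1 := fun a ha h => by
    obtain ⟨c, rfl⟩ := (quadraticChar_one_iff_isSquare ha).1 h
    rw [map_mul]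
    exact hval c (left_ne_zero_of_mul ha)
  obtain ⟨b, hb⟩ := quadraticChar_exists_neg_one' h2
  have hns : ∀ a : F, a ≠ 0 → quadraticChar F a = -1 → ψ a = ψ b := fun a ha h => by
    have h1 := hsqr (a * b) (mul_ne_zero ha b.ne_zero) (by rw [map_mul, h, hb]; norm_num)
    rw [map_mul] at h1
    have h3 := hval b b.ne_zero
    linear_combination ψ b * h1 - ψ a * h3
  rcases mul_self_eq_one_iff.1 (hval b b.ne_zero) with h | h
  · left
    ext a
    rw [MulChar.one_apply_coe]
    rcases quadraticChar_dichotomy a.ne_zero with ha | ha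
    · exact hsqr a a.ne_zero ha
    · rw [hns a a.ne_zero ha, h]
  · right
    ext a
    rw [MulChar.ringHomComp_apply]
    rcases quadraticChar_dichotomy a.ne_zero with ha | ha
    · rw [hsqr a a.ne_zero ha, ha]; simp
    · rw [hns a a.ne_zero ha, h, ha]; simp

lemma jac_dup {F : Type} [Field F] [Fintype F] [DecidableEq F] (h2 : ringChar F ≠ 2)
    (ψ : MulChar F ℂ) (hψ : ψ ≠ 1) :
    ψ 4 * jacobiSum ψ ψ = jacobiSum ((quadraticChar F).ringHomComp (Int.castRingHom ℂ)) ψ := by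
  have h20 : (2 : F) ≠ 0 := Ring.two_ne_zero h2
  have h1 : ψ 4 * jacobiSum ψ ψ = ∑ x : F, ψ (1 - (2 * x - 1) ^ 2) := by
    unfold jacobiSum
    rw [Finset.mul_sum]
    refine Finset.sum_congr rfl fun x _ => ?_
    rw [← map_mul, ← map_mul]
    congr 1
    ring
  have h2' : ∑ x : F, ψ (1 - (2 * x - 1) ^ 2) = ∑ y : F, ψ (1 - y ^ 2) := by
    refine Fintype.sum_equiv ((Equiv.mulLeft₀ (2 : F) h20).trans (Equiv.subRight 1)) _ _ fun x => ?_
    simp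
  have h3 : ∑ y : F, ψ (1 - y ^ 2) =
      ∑ u : F, (((quadraticChar F u : ℤ) : ℂ) + 1) * ψ (1 - u) := by
    rw [← Finset.sum_fiberwise Finset.univ (fun y : F => y ^ 2)]
    refine Finset.sum_congr rfl fun u _ => ?_
    have h := quadraticChar_card_sqrts h2 u
    have hc : (((quadraticChar F u : ℤ) : ℂ) + 1) =
        ((Finset.univ.filter fun y : F => y ^ 2 = u).card : ℂ) := by
      have : ({x : F | x ^ 2 = u}.toFinset) = Finset.univ.filter fun y : F => y ^ 2 = u := by
        ext; simp
      rw [← this]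
      exact_mod_cast h.symm
    rw [hc, ← nsmul_eq_mul, ← Finset.sum_const]
    refine Finset.sum_congr rfl fun y hy => ?_
    rw [(Finset.mem_filter.1 hy).2]
  have h4 : ∑ u : F, ψ (1 - u) = 0 := by
    rw [← MulChar.sum_eq_zero_of_ne_one hψ]
    exact Fintype.sum_equiv (Equiv.subLeft 1) _ _ fun x => by simp
  rw [h1, h2', h3]
  simp only [add_mul, one_mul, Finset.sum_add_distrib, h4, add_zero]
  rfl

lemma hd_two {F : Type} [Field F] [Fintype F] [DecidableEq F] (h2 : ringChar F ≠ 2)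
    (ψ φ : MulChar F ℂ) (hφ : φ = (quadraticChar F).ringHomComp (Int.castRingHom ℂ))
    (hsq : ψ ^ 2 = 1 → ψ = 1 ∨ ψ = φ)
    (θ : AddChar F ℂ) (hθ : θ ≠ 1) :
    gaussSum (ψ * φ) θ * gaussSum ψ θ = gaussSum φ θ * gaussSum (ψ ^ 2) θ * ψ⁻¹ 4 := by
  have h20 : (2 : F) ≠ 0 := Ring.two_ne_zero h2
  have h4 : (4 : F) = 2 ^ 2 := by norm_num
  have h40 : (4 : F) ≠ 0 := by rw [h4]; exact pow_ne_zero _ h20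
  have hφφ : φ ^ 2 = 1 := by
    rw [hφ, ((quadraticChar_isQuadratic F).comp _).sq_eq_one]
  by_cases hs : ψ ^ 2 = 1
  · have e4 : ψ⁻¹ 4 = 1 := by
      have : ψ⁻¹ ^ 2 = 1 := by rw [inv_pow, hs, inv_one]
      rw [h4, map_pow, ← MulChar.pow_apply' _ two_ne_zero, this]
      exact MulChar.one_apply (isUnit_iff_ne_zero.2 h20)
    rw [e4, hs, mul_one]
    rcases hsq hs with h | h
    · rw [h, one_mul]
    · rw [h, ← sq, hφφ, mul_comm]
  · have h1 : ψ ≠ 1 := by rintro rfl; simp at hs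
    have hm : ψ * φ ≠ 1 := by
      intro h
      apply hs
      have := congrArg (· ^ 2) h
      simpa [mul_pow, hφφ] using this
    have a := jacobiSum_mul_nontrivial (by rwa [← sq] : ψ * ψ ≠ 1) θ
    have b := jacobiSum_mul_nontrivial (by rwa [mul_comm] : φ * ψ ≠ 1) θ
    have c := jac_dup h2 ψ h1
    rw [← hφ] at c
    have hg : gaussSum ψ θ ≠ 0 := gaussSum_ne_zero_of_nontrivial
      (by exact_mod_cast Fintype.card_ne_zero) h1 (AddChar.IsPrimitive.of_ne_one hθ)
    have hi : ψ⁻¹ 4 * ψ 4 = 1 := by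
      rw [← MulChar.mul_apply, inv_mul_cancel]
      exact MulChar.one_apply (isUnit_iff_ne_zero.2 h40)
    apply mul_right_cancel₀ hg
    rw [← sq] at a
    rw [mul_comm φ ψ] at b
    linear_combination (-gaussSum (ψ * φ) θ) * a + ψ⁻¹ 4 * gaussSum (ψ ^ 2) θ * b
      + ψ⁻¹ 4 * gaussSum (ψ ^ 2) θ * gaussSum (ψ * φ) θ * c
      - jacobiSum ψ ψ * gaussSum (ψ ^ 2) θ * gaussSum (ψ * φ) θ * hi

/-- Equation (3.12) of the paper (Hasse–Davenport product relation for `m = 2`):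
`G_{-l+(q-1)/2} · G_{-l} = G_{(q-1)/2} · G_{-2l} · T^l(4)`. -/
theorem gauss_sum_hasse_davenport_m2
    {p r : ℕ} (hp : p.Prime) (hp2 : Odd p) (hr : 0 < r)
    {F : Type} [Field F] [Fintype F] [DecidableEq F]
    (hcard : Fintype.card F = p ^ r)
    (T : MulChar F ℂ) (hT : ∀ χ : MulChar F ℂ, ∃ n : ℤ, χ = T ^ n)
    (θ : AddChar F ℂ) (hθ : θ ≠ 1)
    (G : ℤ → ℂ) (hG : ∀ m : ℤ, G m = gaussSum (T ^ m) θ)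
    (l : ℤ) :
    G (-l + (((p ^ r - 1) / 2 : ℕ) : ℤ)) * G (-l) =
      G (((p ^ r - 1) / 2 : ℕ)) * G (-2 * l) * (T ^ l) (4 : F) := by
  have hodd : Odd (Fintype.card F) := by rw [hcard]; exact hp2.pow
  have h2 : ringChar F ≠ 2 := by
    intro h
    have := FiniteField.even_card_of_char_two h
    rw [Nat.odd_iff] at hodd
    omega
  have hcard1 : 1 < Fintype.card F := Fintype.one_lt_card
  have hN : (p ^ r - 1) / 2 = Fintype.card F / 2 := by
    rw [← hcard]
    rw [Nat.odd_iff] at hodd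
    omega
  have hN0 : Fintype.card F / 2 ≠ 0 := by
    rw [Nat.odd_iff] at hodd
    omega
  have hneg : (-1 : F) ≠ 1 := Ring.neg_one_ne_one_of_char_ne_two h2
  have hTm : T (-1) = -1 := by
    obtain ⟨χ, hχ⟩ := MulChar.exists_apply_ne_one_of_hasEnoughRootsOfUnity F ℂ hneg
    have hsq : T (-1) * T (-1) = 1 := by rw [← map_mul]; simp
    rcases mul_self_eq_one_iff.1 hsq with h | h
    · exfalso
      obtain ⟨n, rfl⟩ := hT χ
      apply hχ
      have key : ∀ k : ℕ, (T ^ k) (-1) = 1 := fun k => by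
        have := MulChar.pow_apply_coe T k (-1 : Fˣ)
        simpa [h] using this
      have hu : IsUnit (-1 : F) := isUnit_one.neg
      obtain ⟨k, rfl | rfl⟩ := n.eq_nat_or_neg
      · rw [zpow_natCast]; exact key k
      · rw [zpow_neg, zpow_natCast, MulChar.inv_apply_eq_inv', key, inv_one]
    · exact h
  have hTφ : T ^ (Fintype.card F / 2) = (quadraticChar F).ringHomComp (Int.castRingHom ℂ) := by
    ext a
    have ha : (a : F) ≠ 0 := a.ne_zero
    have hq := quadraticChar_eq_pow_of_char_ne_two' h2 (a : F)
    rw [MulChar.pow_apply' _ hN0, ← map_pow, ← hq, MulChar.ringHomComp_apply]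
    rcases quadraticChar_dichotomy ha with h | h <;> simp [h, hTm]
  have hφ2 : (T ^ (Fintype.card F / 2)) ^ 2 = 1 := by
    rw [hTφ, ((quadraticChar_isQuadratic F).comp _).sq_eq_one]
  have main := hd_two h2 (T ^ (-l)) _ hTφ ?_ θ hθ
  · rw [hG, hG, hG, hG, hN, zpow_add, zpow_natCast, main, zpow_neg, inv_inv, inv_pow,
      ← zpow_natCast]
    have e : ((T ^ l) ^ 2)⁻¹ = T ^ (-2 * l) := by
      rw [← zpow_natCast, ← zpow_mul, ← zpow_neg]
      congr 1
      push_cast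
      ring
    rw [e]
  · rw [hTφ]
    exact sq_one_cases h2 _
end

section
/- (Davenport–Hasse relation.) Let m be a positive integer and let q = p^r be a power of a prime p such that q ≡ 1 (mod m). For every multiplicative character ψ of F_q with values in ℂ (extended by ψ(0) = 0), one has ∏_{χ : χ^m = ε} G(χψ) = −G(ψ^m) · ψ(m^{−m}) · ∏_{χ : χ^m = ε} G(χ), where the products run over all multiplicative characters χ of F_q whose m-th power is the trivial character ε, and m^{−m} denotes the inverse of m^m computed in F_q (note p ∤ m since q ≡ 1 (mod m)). -/
open Finset

namespace DH
open Polynomial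

section pw
variable {R : Type*} [Field R]

/-- Reversed polynomial as a power series. -/
noncomputable def rv (g : R[X]) : PowerSeries R := (g.reverse : PowerSeries R)

/-- Generating series of the power sums of the roots. -/
noncomputable def LD (g : R[X]) : PowerSeries R :=
  -(PowerSeries.X * PowerSeries.derivative R (rv g)) * (rv g)⁻¹

/-- Power sums of the roots. -/
noncomputable def pw (k : ℕ) (g : R[X]) : R := PowerSeries.coeff k (LD g)

lemma rv_const {g : R[X]} (hg : g.Monic) : PowerSeries.constantCoeff (rv g) = 1 := by
  rw [rv, ← PowerSeries.coeff_zero_eq_constantCoeff_apply, Polynomial.coeff_coe,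
    coeff_zero_reverse, hg.leadingCoeff]

lemma LD_mul_rv {g : R[X]} (hg : g.Monic) :
    LD g * rv g = -(PowerSeries.X * PowerSeries.derivative R (rv g)) := by
  rw [LD, mul_assoc, PowerSeries.inv_mul_cancel, mul_one]
  rw [rv_const hg]; exact one_ne_zero

lemma rv_ne {g : R[X]} (hg : g.Monic) : rv g ≠ 0 := by
  intro h
  have := rv_const hg
  rw [h] at this
  simp at this

lemma LD_eq_of {g : R[X]} (hg : g.Monic) {A : PowerSeries R}
    (h : A * rv g = -(PowerSeries.X * PowerSeries.derivative R (rv g))) : LD g = A := by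
  apply mul_right_cancel₀ (rv_ne hg)
  rw [LD_mul_rv hg, h]

lemma LD_mul {g h : R[X]} (hg : g.Monic) (hh : h.Monic) : LD (g * h) = LD g + LD h := by
  apply LD_eq_of (hg.mul hh)
  have e : rv (g * h) = rv g * rv h := by
    simp [rv, reverse_mul_of_domain]
  have h1 := LD_mul_rv hg
  have h2 := LD_mul_rv hh
  rw [e, Derivation.leibniz, smul_eq_mul, smul_eq_mul]
  linear_combination (rv h) * h1 + (rv g) * h2

lemma pw_mul {g h : R[X]} (hg : g.Monic) (hh : h.Monic) (k : ℕ) :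
    pw k (g * h) = pw k g + pw k h := by
  simp [pw, LD_mul hg hh]

lemma pw_one (k : ℕ) : pw k (1 : R[X]) = 0 := by
  have := pw_mul (monic_one (R := R)) monic_one k
  simpa using this

lemma pw_pow {g : R[X]} (hg : g.Monic) (k n : ℕ) : pw k (g ^ n) = n * pw k g := by
  induction n with
  | zero => simp [pw_one]
  | succ n ih => rw [pow_succ, pw_mul (hg.pow n) hg, ih]; push_cast; ring

lemma pw_map {S : Type*} [Field S] (f : R →+* S) {g : R[X]} (hg : g.Monic) (k : ℕ) :
    pw k (g.map f) = f (pw k g) := by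
  have hr : rv (g.map f) = PowerSeries.map f (rv g) := by
    ext n
    simp [rv, coeff_reverse, natDegree_map]
  have : LD (g.map f) = PowerSeries.map f (LD g) := by
    apply LD_eq_of (hg.map f)
    rw [hr, ← map_mul, LD_mul_rv hg]
    ext n
    cases n <;> simp [PowerSeries.coeff_succ_X_mul, PowerSeries.coeff_derivative]
  simp [pw, this]

lemma pw_X_sub_C (r : R) {k : ℕ} (hk : k ≠ 0) : pw k (X - C r) = r ^ k := by
  have hr : rv (X - C r) = 1 - PowerSeries.C r * PowerSeries.X := by
    have : (X - C r : R[X]).reverse = 1 - C r * X := by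
      rw [reverse, natDegree_X_sub_C, reflect_sub]
      congr 1
      · simpa using reflect_X_pow (R := R) 1 1
      · simpa using reflect_C_mul_X_pow (R := R) 1 0
    rw [rv, this]
    simp
  have : LD (X - C r) = PowerSeries.mk (fun k => if k = 0 then 0 else r ^ k) := by
    apply LD_eq_of (monic_X_sub_C r)
    rw [hr]
    ext n
    rcases n with _ | _ | n
    · simp
    · rw [mul_sub, ← mul_assoc, mul_comm _ (PowerSeries.C r)]
      simp [PowerSeries.coeff_succ_X_mul, PowerSeries.coeff_succ_mul_X, mul_assoc, PowerSeries.coeff_derivative, PowerSeries.coeff_one]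
    · rw [mul_sub, ← mul_assoc, mul_comm _ (PowerSeries.C r)]
      simp [PowerSeries.coeff_succ_X_mul, PowerSeries.coeff_succ_mul_X, mul_assoc, PowerSeries.coeff_derivative, PowerSeries.coeff_one, PowerSeries.coeff_X]
      ring
  simp [pw, this, hk]

lemma pw_splits {g : R[X]} (hg : g.Monic) (hs : g.Splits) {k : ℕ} (hk : k ≠ 0) :
    pw k g = (g.roots.map (fun r => r ^ k)).sum := by
  have key : ∀ s : Multiset R, pw k (s.map (fun a => X - C a)).prod =
      (s.map (fun r => r ^ k)).sum := by
    intro s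
    induction s using Multiset.induction_on with
    | empty => simp [pw_one]
    | cons a s ih =>
      rw [Multiset.map_cons, Multiset.prod_cons, pw_mul (monic_X_sub_C a)
        (monic_multiset_prod_of_monic _ _ fun i _ => monic_X_sub_C i), ih, pw_X_sub_C a hk]
      simp
  rw [← key]
  congr 1
  exact hs.eq_prod_roots_of_monic hg

lemma pw_add {h : R[X]} {n j : ℕ} (hh : h.Monic) (hn : h.natDegree = n) (hj : 1 ≤ j) (hjn : j ≤ n)
    (c : R) (hg : (h + C c * X ^ (n - j)).Monic) (hgn : (h + C c * X ^ (n - j)).natDegree = n) :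
    pw j (h + C c * X ^ (n - j)) = pw j h - j * c := by
  set g := h + C c * X ^ (n - j) with hgdef
  have e : rv g = rv h + PowerSeries.C c * PowerSeries.X ^ j := by
    have : g.reverse = h.reverse + C c * X ^ j := by
      rw [reverse, hgn, hgdef, reflect_add, reverse, hn, reflect_C_mul_X_pow]
      congr 2
      rw [revAt_le (by omega)]
      congr 1; omega
    rw [rv, this]; simp [rv]
  have h1 := LD_mul_rv hg
  have h2 := LD_mul_rv hh
  have hc : PowerSeries.constantCoeff (LD g) = 0 := by simp [LD]
  obtain ⟨i, rfl⟩ : ∃ i, j = i + 1 := ⟨j - 1, by omega⟩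
  have hd : PowerSeries.derivative R (PowerSeries.C c * PowerSeries.X ^ (i+1) : PowerSeries R) =
     PowerSeries.C c * (((i + 1 : ℕ) : PowerSeries R) * PowerSeries.X ^ i) := by
    rw [Derivation.leibniz, PowerSeries.derivative_pow]
    simp
  rw [e, map_add, hd] at h1
  have h3 : (LD g - LD h) * rv h =
      PowerSeries.X ^ (i+1) * (- (PowerSeries.C c * ((i + 1 : ℕ) : PowerSeries R)) - PowerSeries.C c * LD g) := by
    linear_combination h1 - h2
  have h4 : LD g - LD h =
      PowerSeries.X ^ (i+1) * ((- (PowerSeries.C c * ((i + 1 : ℕ) : PowerSeries R)) - PowerSeries.C c * LD g)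
        * (rv h)⁻¹) := by
    rw [← mul_assoc, ← h3, mul_assoc, PowerSeries.mul_inv_cancel, mul_one]
    rw [rv_const hh]; exact one_ne_zero
  have h5 := congrArg (PowerSeries.coeff (i+1)) h4
  rw [PowerSeries.coeff_X_pow_mul', if_pos le_rfl] at h5
  simp [hc, rv_const hh] at h5
  simp only [pw]
  push_cast
  linear_combination h5

end pw

section ext
variable {F : Type*} [Field F]

/-- Norm of a polynomial (product of the roots). -/
noncomputable def nn (g : F[X]) : F := (-1) ^ g.natDegree * g.coeff 0

lemma nn_mul {g h : F[X]} (hg : g.Monic) (hh : h.Monic) : nn (g * h) = nn g * nn h := by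
  rw [nn, hg.natDegree_mul hh, mul_coeff_zero, nn, nn]; ring

lemma nn_pow {g : F[X]} (hg : g.Monic) (n : ℕ) : nn (g ^ n) = nn g ^ n := by
  induction n with
  | zero => simp [nn]
  | succ n ih => rw [pow_succ, nn_mul (hg.pow n) hg, ih, pow_succ]

variable {K : Type*} [Field K] [Algebra F K] [FiniteDimensional F K]

open IntermediateField Module

variable (F) in
/-- Characteristic polynomial. -/
noncomputable def P (x : K) : F[X] := minpoly F x ^ finrank F⟮x⟯ K

lemma mp_monic (x : K) : (minpoly F x).Monic := minpoly.monic (IsIntegral.of_finite F x)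

lemma P_monic (x : K) : (P F x).Monic := (mp_monic x).pow _

lemma deg_mul (x : K) : (minpoly F x).natDegree * finrank F⟮x⟯ K = finrank F K := by
  rw [← IntermediateField.adjoin.finrank (IsIntegral.of_finite F x), finrank_mul_finrank]

lemma P_natDegree (x : K) : (P F x).natDegree = finrank F K := by
  rw [P, (mp_monic x).natDegree_pow, mul_comm, deg_mul]

lemma nn_P (x : K) : nn (P F x) = Algebra.norm F x := by
  rw [P, nn_pow (mp_monic x), Algebra.norm_eq_norm_adjoin F x]
  congr 1
  have hx := IsIntegral.of_finite F x
  have := Algebra.PowerBasis.norm_gen_eq_coeff_zero_minpoly (IntermediateField.adjoin.powerBasis hx)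
  rw [IntermediateField.adjoin.powerBasis_gen, IntermediateField.minpoly_gen] at this
  rw [this, nn]
  rfl

lemma pw_P [Algebra.IsSeparable F K] (x : K) {j : ℕ} (hj : j ≠ 0) :
    pw j (P F x) = Algebra.trace F K (x ^ j) := by
  have hx := IsIntegral.of_finite F x
  have h1 : Algebra.trace F K (x ^ j) =
      finrank F⟮x⟯ K • Algebra.trace F F⟮x⟯ (AdjoinSimple.gen F x ^ j) := by
    have : x ^ j = algebraMap F⟮x⟯ K (AdjoinSimple.gen F x ^ j) := by simp
    rw [this, ← Algebra.trace_trace (S := F⟮x⟯), Algebra.trace_algebraMap, map_nsmul]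
  have hsep := Algebra.isSeparable_tower_bot_of_isSeparable F F⟮x⟯ K
  rw [h1, P, pw_pow (mp_monic x), nsmul_eq_mul]
  congr 1
  let E := AlgebraicClosure F
  apply (algebraMap F E).injective
  let pb := IntermediateField.adjoin.powerBasis hx
  have hgen : pb.gen = AdjoinSimple.gen F x := IntermediateField.adjoin.powerBasis_gen hx
  rw [trace_eq_sum_embeddings E, ← pw_map _ (mp_monic x),
    pw_splits ((mp_monic x).map _) (IsAlgClosed.splits _) hj]
  have hmin : minpoly F pb.gen = minpoly F x := by
    rw [hgen, IntermediateField.minpoly_gen]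
  classical
  rw [Fintype.sum_equiv pb.liftEquiv' _ (fun y => (y : E) ^ j), hmin]
  · rw [Finset.sum_mem_multiset (f := fun y => (y : E) ^ j) (g := fun y => (y : E) ^ j) _
      (fun _ => rfl), Finset.sum_eq_multiset_sum, Multiset.toFinset_val, Multiset.dedup_eq_self.mpr]
    exact nodup_roots ((separable_map _).mpr (Algebra.IsSeparable.isSeparable F x))
  · intro σ
    rw [PowerBasis.liftEquiv'_apply_coe, hgen, map_pow]

lemma card_minpoly [Finite F] [Fintype K] [DecidableEq F[X]] {f : F[X]} (hf : Irreducible f) (hm : f.Monic)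
    (hd : f.natDegree ∣ finrank F K) :
    (univ.filter (fun x : K => minpoly F x = f)).card = f.natDegree := by
  classical
  have hs : (f.map (algebraMap F K)).Splits := by
    have h1 := hf.natDegree_dvd_iff_dvd_X_pow_card_pow_sub_X.mp hd
    rw [← Module.natCard_eq_pow_finrank] at h1
    have h2 := Polynomial.map_dvd (algebraMap F K) h1
    refine Splits.of_dvd ?_ ?_ h2
    · have := FiniteField.isSplittingField_sub K F
      rw [← Fintype.card_eq_nat_card]
      exact this.splits
    · exact map_ne_zero (FiniteField.X_pow_card_sub_X_ne_zero _ Finite.one_lt_card)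
  have hsep : f.Separable := PerfectField.separable_of_irreducible hf
  rw [← Polynomial.card_rootSet_eq_natDegree hsep hs, ← Set.toFinset_card]
  congr 1
  ext x
  simp only [mem_filter, mem_univ, true_and, Set.mem_toFinset, mem_rootSet, hm.ne_zero, ne_eq,
    not_false_eq_true]
  constructor
  · rintro rfl; exact minpoly.aeval F x
  · intro h; exact (minpoly.eq_of_irreducible_of_monic hf h hm).symm

end ext

section euler
variable {F : Type*} [Field F] [Finite F]

lemma finite_monic (n : ℕ) : {g : F[X] | g.Monic ∧ g.natDegree = n}.Finite := by
  apply Set.Finite.of_finite_image (f := fun g : F[X] => fun i : Fin n => g.coeff i)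
    (Set.toFinite _)
  rintro g ⟨hg, hgn⟩ h ⟨hh, hhn⟩ e
  ext i
  rcases lt_trichotomy i n with hi | rfl | hi
  · exact congrFun e ⟨i, hi⟩
  · have h1 := hg.coeff_natDegree
    have h2 := hh.coeff_natDegree
    rw [hgn] at h1
    rw [hhn] at h2
    rw [h1, h2]
  · rw [coeff_eq_zero_of_natDegree_lt (by omega), coeff_eq_zero_of_natDegree_lt (by omega)]

variable (F) in
/-- Monic polynomials of degree `n`. -/
noncomputable def MF (n : ℕ) : Finset F[X] := (finite_monic (F := F) n).toFinset

lemma mem_MF {n : ℕ} {g : F[X]} : g ∈ MF F n ↔ g.Monic ∧ g.natDegree = n := by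
  simp [MF]

open Module UniqueFactorizationMonoid

lemma count_index (n d e : ℕ) (hd : 0 < d) (h : d * e ≤ n) :
    ((range n).filter (fun i => d ∣ i + 1 ∧ (i + 1) / d ≤ e)).card = e := by
  have : (range n).filter (fun i => d ∣ i + 1 ∧ (i + 1) / d ≤ e) =
      (range e).image (fun j => d * (j + 1) - 1) := by
    ext i
    simp only [mem_filter, mem_range, mem_image]
    constructor
    · rintro ⟨hi, ⟨c, hc⟩, h2⟩
      rw [hc, Nat.mul_div_cancel_left _ hd] at h2
      have : c ≠ 0 := by rintro rfl; omega
      refine ⟨c - 1, by omega, ?_⟩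
      rw [Nat.sub_add_cancel (by omega), ← hc]; rfl
    · rintro ⟨j, hj, rfl⟩
      have h1 : 0 < d * (j + 1) := by positivity
      have h2 : d * (j + 1) ≤ d * e := Nat.mul_le_mul_left _ hj
      rw [Nat.sub_add_cancel h1, Nat.mul_div_cancel_left _ hd]
      exact ⟨by omega, dvd_mul_right _ _, hj⟩
  rw [this, card_image_of_injective, card_range]
  intro a b hab
  have h1 : 0 < d * (a + 1) := by positivity
  have h2 : 0 < d * (b + 1) := by positivity
  have h3 : d * (a + 1) = d * (b + 1) := by simp only at hab; omega
  have := Nat.eq_of_mul_eq_mul_left hd h3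
  omega

variable (K : ℕ → Type*) [∀ k, Field (K k)] [∀ k, Fintype (K k)] [∀ k, Algebra F (K k)]
  [∀ k, FiniteDimensional F (K k)]

open scoped Classical in
lemma count_lemma (hK : ∀ k, finrank F (K k) = k + 1) {g : F[X]} {n : ℕ} (hg : g.Monic)
    (hn : g.natDegree = n) :
    ∑ k ∈ range n, (univ.filter (fun x : K k => P F x ∣ g)).card = n := by
  set T := normalizedFactors g with hT
  have hTmem : ∀ f ∈ T, Irreducible f ∧ f.Monic ∧ f ∣ g := fun f hf =>
    ⟨irreducible_of_normalized_factor f hf, by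
      have := normalize_normalized_factor f hf
      rw [← this]
      exact monic_normalize (irreducible_of_normalized_factor f hf).ne_zero,
      dvd_of_mem_normalizedFactors hf⟩
  have hmon : ∀ (k : ℕ) (x : K k), P F x ∣ g → minpoly F x ∈ T := by
    intro k x hx
    rw [hT, Polynomial.mem_normalizedFactors_iff hg.ne_zero]
    refine ⟨minpoly.irreducible (IsIntegral.of_finite F x), mp_monic x, ?_⟩
    refine (dvd_pow_self _ ?_).trans hx
    intro h0
    have := deg_mul (F := F) x
    rw [h0, hK] at this
    omega
  have hpow : ∀ f ∈ T, ∀ e : ℕ, f ^ e ∣ g ↔ e ≤ T.count f := by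
    intro f hf e
    obtain ⟨h1, h2, h3⟩ := hTmem f hf
    rw [pow_dvd_iff_le_emultiplicity, emultiplicity_eq_count_normalizedFactors h1 hg.ne_zero,
      h2.normalize_eq_self]
    exact Nat.cast_le
  have step : ∀ k, (univ.filter (fun x : K k => P F x ∣ g)).card =
      ∑ f ∈ T.toFinset,
        if (f.natDegree ∣ k + 1 ∧ (k + 1) / f.natDegree ≤ T.count f) then f.natDegree else 0 := by
    intro k
    rw [card_eq_sum_card_fiberwise (f := fun x => minpoly F x) (t := T.toFinset)]
    · apply sum_congr rfl
      intro f hf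
      rw [Multiset.mem_toFinset] at hf
      obtain ⟨h1, h2, h3⟩ := hTmem f hf
      have hP : ∀ x : K k, minpoly F x = f →
          f.natDegree ∣ k + 1 ∧ P F x = f ^ ((k + 1) / f.natDegree) := by
        intro x hx
        have := deg_mul (F := F) x
        rw [hx, hK] at this
        refine ⟨⟨_, this.symm⟩, ?_⟩
        rw [P, hx, ← this, Nat.mul_div_cancel_left _ h1.natDegree_pos]
      rw [filter_filter]
      split_ifs with hc
      · rw [← card_minpoly (K := K k) h1 h2 (by rw [hK]; exact hc.1)]
        congr 1
        apply filter_congr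
        intro x _
        constructor
        · exact fun h => h.2
        · intro h
          refine ⟨?_, h⟩
          rw [(hP x h).2, hpow f hf]
          exact hc.2
      · rw [card_eq_zero, filter_eq_empty_iff]
        rintro x _ ⟨ha, hb⟩
        apply hc
        refine ⟨(hP x hb).1, ?_⟩
        rw [← hpow f hf, ← (hP x hb).2]
        exact ha
    · intro x hx
      simp only [coe_filter, mem_univ, true_and, Set.mem_setOf_eq] at hx
      simpa using hmon k x hx
  rw [sum_congr rfl (fun k _ => step k), sum_comm]
  have h2 : ∀ f ∈ T.toFinset, (∑ k ∈ range n,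
      if (f.natDegree ∣ k + 1 ∧ (k + 1) / f.natDegree ≤ T.count f) then f.natDegree else 0) =
      T.count f • f.natDegree := by
    intro f hf
    rw [Multiset.mem_toFinset] at hf
    obtain ⟨h1, h2, h3⟩ := hTmem f hf
    rw [← sum_filter, sum_const, count_index _ _ _ h1.natDegree_pos]
    have h4 := (hpow f hf _).mpr le_rfl
    have := natDegree_le_of_dvd h4 hg.ne_zero
    rw [h2.natDegree_pow, hn] at this
    rw [mul_comm]; exact this
  rw [sum_congr rfl h2, ← Finset.sum_multiset_map_count, ← natDegree_multiset_prod']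
  · rw [← hn]
    apply natDegree_eq_of_degree_eq
    exact degree_eq_degree_of_associated (prod_normalizedFactors hg.ne_zero)
  · rw [Multiset.prod_eq_one]
    · exact one_ne_zero
    · intro x hx
      rw [Multiset.mem_map] at hx
      obtain ⟨f, hf, rfl⟩ := hx
      exact (hTmem f hf).2.1.leadingCoeff

lemma euler (hK : ∀ k, finrank F (K k) = k + 1) (l : F[X] → ℂ)
    (hl : ∀ g h : F[X], g.Monic → h.Monic → l (g * h) = l g * l h) (n : ℕ) :
    (n : ℂ) * ∑ g ∈ MF F n, l g =
      ∑ k ∈ range n, (∑ x : K k, l (P F x)) * ∑ g ∈ MF F (n - 1 - k), l g := by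
  classical
  have h1 : (n : ℂ) * ∑ g ∈ MF F n, l g = ∑ g ∈ MF F n, ∑ k ∈ range n, ∑ x : K k,
      if P F x ∣ g then l g else 0 := by
    rw [mul_sum]
    apply sum_congr rfl
    intro g hg
    rw [mem_MF] at hg
    have := count_lemma K hK hg.1 hg.2
    have h' := congrArg (Nat.cast : ℕ → ℂ) this.symm
    refine (congrArg (· * l g) h').trans ?_
    simp only [Nat.cast_sum, sum_mul]
    apply sum_congr rfl
    intro k _
    rw [← sum_filter, sum_const, nsmul_eq_mul]
  rw [h1, sum_comm]
  apply sum_congr rfl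
  intro k hk
  rw [mem_range] at hk
  rw [sum_comm, sum_mul]
  apply sum_congr rfl
  intro x _
  rw [mul_sum, ← sum_filter]
  symm
  have hdeg := P_natDegree (F := F) x
  rw [hK] at hdeg
  apply sum_bij (fun g _ => P F x * g)
  · intro g hg
    rw [mem_MF] at hg
    rw [mem_filter, mem_MF]
    refine ⟨⟨(P_monic x).mul hg.1, ?_⟩, dvd_mul_right _ _⟩
    rw [(P_monic x).natDegree_mul hg.1, hdeg, hg.2]
    omega
  · intro a _ b _ h
    exact mul_left_cancel₀ (P_monic x).ne_zero h
  · intro b hb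
    rw [mem_filter, mem_MF] at hb
    obtain ⟨⟨hb1, hb2⟩, c, rfl⟩ := hb
    have hc := (P_monic x).of_mul_monic_left hb1
    refine ⟨c, ?_, rfl⟩
    rw [mem_MF]
    refine ⟨hc, ?_⟩
    rw [(P_monic x).natDegree_mul hc, hdeg] at hb2
    omega
  · intro g hg
    rw [mem_MF] at hg
    rw [hl _ _ (P_monic x) hg.1]

end euler

section final

lemma prod_deriv {ι : Type*} (s : Finset ι) (A S : ι → PowerSeries ℂ)
    (h : ∀ i ∈ s, PowerSeries.derivative ℂ (A i) = S i * A i) :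
    PowerSeries.derivative ℂ (∏ i ∈ s, A i) = (∑ i ∈ s, S i) * ∏ i ∈ s, A i := by
  classical
  induction s using Finset.induction_on with
  | empty => simp [PowerSeries.derivative_one]
  | insert a s ha ih =>
    rw [prod_insert ha, sum_insert ha, Derivation.leibniz, smul_eq_mul, smul_eq_mul,
      ih (fun i hi => h i (mem_insert_of_mem hi)), h a (mem_insert_self _ _)]
    ring

lemma deriv_unique {A B S : PowerSeries ℂ} (hA : PowerSeries.derivative ℂ A = S * A)
    (hB : PowerSeries.derivative ℂ B = S * B) (hA0 : PowerSeries.constantCoeff A = 1)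
    (hB0 : PowerSeries.constantCoeff B = 1) : A = B := by
  have hBi : B * B⁻¹ = 1 := PowerSeries.mul_inv_cancel _ (by rw [hB0]; exact one_ne_zero)
  have : A * B⁻¹ = 1 := by
    apply PowerSeries.derivative.ext
    · rw [Derivation.leibniz, PowerSeries.derivative_inv', hA, hB, smul_eq_mul, smul_eq_mul,
        PowerSeries.derivative_one]
      linear_combination (- A * S * B⁻¹) * hBi
    · simp [hA0, hB0]
  calc A = A * (B * B⁻¹) := by rw [hBi, mul_one]
    _ = (A * B⁻¹) * B := by ring
    _ = B := by rw [this, one_mul]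

lemma coeff_prod_lin {ι : Type*} (s : Finset ι) (G : ι → ℂ) :
    PowerSeries.coeff s.card (∏ i ∈ s, (1 + PowerSeries.C (G i) * PowerSeries.X)) =
      ∏ i ∈ s, G i := by
  have h := Polynomial.coeff_prod_of_natDegree_le s (fun i => 1 + C (G i) * X) 1 (by
    intro p _
    compute_degree)
  rw [mul_one] at h
  have e : (∏ i ∈ s, (1 + PowerSeries.C (G i) * PowerSeries.X) : PowerSeries ℂ) =
      ((∏ i ∈ s, (1 + C (G i) * X) : ℂ[X]) : PowerSeries ℂ) := by
    rw [← Polynomial.coeToPowerSeries.ringHom_apply, map_prod]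
    simp
  rw [e, Polynomial.coeff_coe, h]
  apply prod_congr rfl
  intro i _
  simp [coeff_one]

variable {F : Type*} [Field F] [Fintype F]

lemma card_chars {m : ℕ} (hm : m ∣ Fintype.card F - 1) (s : Finset (MulChar F ℂ))
    (hs : ∀ χ, χ ∈ s ↔ χ ^ m = 1) : s.card = m := by
  classical
  obtain ⟨e⟩ := MulChar.mulEquiv_units F ℂ
  have hc : IsCyclic (MulChar F ℂ) := isCyclic_of_surjective e.symm e.symm.surjective
  have h1 := IsCyclic.card_powMonoidHom_ker (MulChar F ℂ) m
  rw [MulChar.card_eq_card_units_of_hasEnoughRootsOfUnity, Nat.card_eq_fintype_card (α := Fˣ),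
    Fintype.card_units, Nat.gcd_eq_right hm] at h1
  rw [← h1, ← Nat.card_eq_finsetCard s]
  apply Nat.card_congr
  apply Equiv.subtypeEquivRight
  intro χ
  simp [hs, MonoidHom.mem_ker]

lemma count_roots {m : ℕ} (hm0 : 0 < m) (hm : m ∣ Fintype.card F - 1)
    (s : Finset (MulChar F ℂ)) (hs : ∀ χ, χ ∈ s ↔ χ ^ m = 1)
    {K : Type*} [Field K] [Fintype K] [DecidableEq K] [Algebra F K] {z : K} (hz : z ≠ 0) :
    ((univ.filter (fun x : K => x ^ m = z)).card : ℂ) = ∑ χ ∈ s, χ (Algebra.norm F z) := by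
  classical
  -- primitive root
  obtain ⟨γ, hγ⟩ := IsCyclic.exists_generator (α := Kˣ)
  have hNγ : ∀ x, x ∈ Subgroup.zpowers (Units.map (Algebra.norm F (S := K)) γ) := by
    intro x
    obtain ⟨y, rfl⟩ := FiniteField.unitsMap_norm_surjective F K x
    obtain ⟨i, rfl⟩ := hγ y
    exact ⟨i, by simp⟩
  obtain ⟨ζ, hζ⟩ : ∃ ζ : K, IsPrimitiveRoot ζ m := by
    obtain ⟨g, hg⟩ := IsCyclic.exists_ofOrder_eq_natCard (α := Fˣ)
    have h1 := IsPrimitiveRoot.orderOf g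
    rw [hg, Nat.card_eq_fintype_card, Fintype.card_units] at h1
    obtain ⟨c, hc⟩ := hm
    have hpos : 0 < Fintype.card F - 1 := by
      have := Fintype.one_lt_card (α := F); omega
    have h2 := h1.pow hpos (a := c) (b := m) (by rw [hc, mul_comm])
    exact ⟨algebraMap F K ((g ^ c : Fˣ) : F),
      (h2.map_of_injective (f := Units.coeHom F) Units.val_injective).map_of_injective
        (algebraMap F K).injective⟩
  have hcount : (univ.filter (fun x : K => x ^ m = z)).card =
      if ∃ α, α ^ m = z then m else 0 := by
    have e : (univ.filter (fun x : K => x ^ m = z)).card = Multiset.card (nthRoots m z) := by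
      rw [← Multiset.toFinset_card_of_nodup (hζ.nthRoots_nodup hz)]
      congr 1
      ext x
      simp [Polynomial.mem_nthRoots hm0]
    rw [e, hζ.card_nthRoots z]
    congr
  rw [hcount]
  split_ifs with h
  · obtain ⟨w, rfl⟩ := h
    have hw : w ≠ 0 := by
      rintro rfl
      exact hz (zero_pow hm0.ne')
    have : ∀ χ ∈ s, χ (Algebra.norm F (w ^ m)) = 1 := by
      intro χ hχ
      rw [map_pow, map_pow, ← MulChar.pow_apply' _ hm0.ne', (hs χ).mp hχ, MulChar.one_apply]
      exact ((Algebra.norm_ne_zero_iff).mpr hw).isUnit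
    rw [sum_congr rfl this]
    simp [card_chars hm s hs]
  · obtain ⟨χ0, hχ0⟩ := MulChar.exists_mulChar_orderOf F hm (Complex.isPrimitiveRoot_exp m hm0.ne')
    obtain ⟨i, hi⟩ : ∃ i : ℕ, γ ^ i = Units.mk0 z hz := by
      have := hγ (Units.mk0 z hz)
      rwa [← mem_powers_iff_mem_zpowers] at this
    have hzi : z = (γ : K) ^ i := by
      have := congrArg Units.val hi
      simpa using this.symm
    have hne : χ0 (Algebra.norm F z) ≠ 1 := by
      intro h1
      apply h
      have hi0 : i ≠ 0 := by
        rintro rfl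
        exact h ⟨1, by simp [hzi]⟩
      have : χ0 ^ i = 1 := by
        rw [MulChar.eq_iff hNγ, MulChar.pow_apply' _ hi0]
        rw [hzi, map_pow, map_pow] at h1
        rw [MulChar.one_apply (Units.isUnit _)]
        simpa using h1
      have hd := orderOf_dvd_of_pow_eq_one this
      rw [hχ0] at hd
      obtain ⟨c, rfl⟩ := hd
      exact ⟨(γ : K) ^ c, by rw [hzi, ← pow_mul, mul_comm]⟩
    have hshift : ∑ χ ∈ s, χ (Algebra.norm F z) =
        χ0 (Algebra.norm F z) * ∑ χ ∈ s, χ (Algebra.norm F z) := by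
      have hχm : χ0 ^ m = 1 := by rw [← hχ0]; exact pow_orderOf_eq_one χ0
      rw [mul_sum]
      symm
      apply sum_bij (fun χ _ => χ0 * χ)
      · intro χ hχ
        rw [hs] at hχ ⊢
        rw [mul_pow, hχ, hχm, one_mul]
      · intro a _ b _ hab
        exact mul_left_cancel hab
      · intro b hb
        refine ⟨χ0⁻¹ * b, ?_, by simp⟩
        rw [hs] at hb ⊢
        rw [mul_pow, hb, inv_pow, hχm, inv_one, one_mul]
      · intro χ _
        rfl
    have h0 : (1 - χ0 (Algebra.norm F z)) * ∑ χ ∈ s, χ (Algebra.norm F z) = 0 := by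
      linear_combination hshift
    rcases mul_eq_zero.mp h0 with h2 | h2
    · exact absurd (sub_eq_zero.mp h2).symm hne
    · rw [h2]; simp

lemma sum_lemma {m : ℕ} (hm0 : 0 < m) (hm : m ∣ Fintype.card F - 1)
    (s : Finset (MulChar F ℂ)) (hs : ∀ χ, χ ∈ s ↔ χ ^ m = 1)
    (K : Type*) [Field K] [Fintype K] [Algebra F K] (θ : AddChar F ℂ) (ψ : MulChar F ℂ) :
    ∑ x : K, (ψ ^ m) (Algebra.norm F x) * θ (Algebra.trace F K (x ^ m)) =
      ∑ χ ∈ s, ∑ x : K, (χ * ψ) (Algebra.norm F x) * θ (Algebra.trace F K (x ^ 1)) := by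
  classical
  have h1 : ∀ x : K, (ψ ^ m) (Algebra.norm F x) * θ (Algebra.trace F K (x ^ m)) =
      ψ (Algebra.norm F (x ^ m)) * θ (Algebra.trace F K (x ^ m)) := by
    intro x
    rw [MulChar.pow_apply' _ hm0.ne', map_pow (Algebra.norm F), map_pow ψ]
  rw [sum_congr rfl (fun x _ => h1 x), sum_comm,
    ← sum_fiberwise (s := univ) (g := fun x : K => x ^ m)]
  apply sum_congr rfl
  intro z _
  rw [sum_congr rfl (g := fun _ => ψ (Algebra.norm F z) * θ (Algebra.trace F K z))]
  · rw [sum_const, nsmul_eq_mul]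
    by_cases hz : z = 0
    · subst hz
      have : (Algebra.norm F (0 : K)) = 0 := by
        simp
      have h0 : ψ 0 = 0 := MulChar.map_zero ψ
      simp [this, h0]
    · rw [count_roots hm0 hm s hs hz, sum_mul]
      apply sum_congr rfl
      intro χ _
      rw [MulChar.mul_apply, pow_one]; ring
  · intro x hx
    rw [mem_filter] at hx
    rw [hx.2]

/-- The multiplicative function on monic polynomials. -/
noncomputable def lam (θ : AddChar F ℂ) (μ : MulChar F ℂ) (j : ℕ) (g : F[X]) : ℂ :=
  μ (nn g) * θ (pw j g)

lemma lam_mul (θ : AddChar F ℂ) (μ : MulChar F ℂ) (j : ℕ) (g h : F[X]) (hg : g.Monic)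
    (hh : h.Monic) : lam θ μ j (g * h) = lam θ μ j g * lam θ μ j h := by
  rw [lam, nn_mul hg hh, pw_mul hg hh, map_mul, AddChar.map_add_eq_mul, lam, lam]; ring

/-- The L-series. -/
noncomputable def Ls (θ : AddChar F ℂ) (μ : MulChar F ℂ) (j : ℕ) : PowerSeries ℂ :=
  PowerSeries.mk fun n => ∑ g ∈ MF F n, lam θ μ j g

lemma MF_zero : MF F 0 = {1} := by
  ext g
  rw [mem_MF, mem_singleton]
  constructor
  · rintro ⟨h1, h2⟩; exact h1.natDegree_eq_zero.mp h2
  · rintro rfl; exact ⟨monic_one, natDegree_one⟩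

lemma Ls_const (θ : AddChar F ℂ) (μ : MulChar F ℂ) (j : ℕ) :
    PowerSeries.constantCoeff (Ls θ μ j) = 1 := by
  rw [← PowerSeries.coeff_zero_eq_constantCoeff_apply, Ls, PowerSeries.coeff_mk, MF_zero,
    sum_singleton, lam, pw_one]
  simp [nn]

lemma Ls_deriv (K : ℕ → Type*) [∀ k, Field (K k)] [∀ k, Fintype (K k)] [∀ k, Algebra F (K k)]
    (hK : ∀ k, Module.finrank F (K k) = k + 1) (θ : AddChar F ℂ) (μ : MulChar F ℂ) {j : ℕ}
    (hj : j ≠ 0) :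
    PowerSeries.derivative ℂ (Ls θ μ j) = PowerSeries.mk (fun k =>
      ∑ x : K k, μ (Algebra.norm F x) * θ (Algebra.trace F (K k) (x ^ j))) * Ls θ μ j := by
  have hfd : ∀ k, FiniteDimensional F (K k) := fun k => inferInstance
  ext n
  have h := euler K hK (lam θ μ j) (lam_mul θ μ j) (n + 1)
  rw [PowerSeries.coeff_derivative, PowerSeries.coeff_mul,
    Finset.Nat.sum_antidiagonal_eq_sum_range_succ_mk]
  simp only [Ls, PowerSeries.coeff_mk]
  push_cast at h
  rw [mul_comm, h]
  apply sum_congr rfl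
  intro k _
  congr 1
  apply sum_congr rfl
  intro x _
  rw [lam, nn_P, pw_P x hj]

lemma monic_shift {h : F[X]} {n j : ℕ} (hh : h.Monic) (hn : h.natDegree = n) (hj : 1 ≤ j)
    (hjn : j ≤ n) (c : F) : (h + C c * X ^ (n - j)) ∈ MF F n := by
  have hd : (C c * X ^ (n - j)).degree < h.degree := by
    rw [degree_eq_natDegree hh.ne_zero, hn]
    refine (degree_C_mul_X_pow_le _ _).trans_lt ?_
    exact_mod_cast (by omega : n - j < n)
  rw [mem_MF]
  refine ⟨hh.add_of_left hd, ?_⟩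
  rw [natDegree_add_eq_left_of_degree_lt hd, hn]

lemma Ls_one (θ : AddChar F ℂ) (hθ : θ ≠ 1) (μ : MulChar F ℂ) :
    Ls θ μ 1 = 1 + PowerSeries.C (gaussSum μ θ) * PowerSeries.X := by
  ext n
  rcases n with _ | _ | n
  · have := Ls_const θ μ 1
    simpa using this
  · rw [Ls, PowerSeries.coeff_mk]
    simp only [map_add, PowerSeries.coeff_one, PowerSeries.coeff_C_mul, PowerSeries.coeff_X]
    simp only [zero_add, one_ne_zero, if_false, if_true, mul_one]
    rw [gaussSum]
    symm
    apply sum_bij (fun c _ => X - C c)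
    · intro c _
      rw [mem_MF]
      exact ⟨monic_X_sub_C c, natDegree_X_sub_C c⟩
    · intro a _ b _ h
      simpa using h
    · intro g hg
      rw [mem_MF] at hg
      refine ⟨- g.coeff 0, mem_univ _, ?_⟩
      rw [hg.1.eq_X_add_C hg.2]
      simp
    · intro c _
      rw [lam, pw_X_sub_C c one_ne_zero, nn, natDegree_X_sub_C]
      simp
  · rw [Ls, PowerSeries.coeff_mk]
    have hr : PowerSeries.coeff (n + 1 + 1) (1 + PowerSeries.C (gaussSum μ θ) * PowerSeries.X) =
        0 := by
      simp [PowerSeries.coeff_one, PowerSeries.coeff_X]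
    rw [hr]
    obtain ⟨b, hb⟩ : ∃ b, θ b ≠ 1 := by
      by_contra! hcon
      exact hθ (by ext x; simp [hcon x])
    set N := n + 1 + 1 with hN
    have hshift : ∑ g ∈ MF F N, lam θ μ 1 g = θ b * ∑ g ∈ MF F N, lam θ μ 1 g := by
      rw [mul_sum]
      symm
      apply sum_bij (fun g _ => g + C (-b) * X ^ (N - 1))
      · intro g hg
        rw [mem_MF] at hg
        exact monic_shift hg.1 hg.2 le_rfl (by omega) _
      · intro a _ c _ h
        exact add_right_cancel h
      · intro g hg
        rw [mem_MF] at hg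
        refine ⟨g + C b * X ^ (N - 1), monic_shift hg.1 hg.2 le_rfl (by omega) _, ?_⟩
        simp
      · intro g hg
        rw [mem_MF] at hg
        have h1 := monic_shift hg.1 hg.2 le_rfl (by omega : 1 ≤ N) (-b)
        rw [mem_MF] at h1
        rw [lam, lam, pw_add hg.1 hg.2 le_rfl (by omega) _ h1.1 h1.2, nn, nn, h1.2, hg.2,
          coeff_add, coeff_C_mul, coeff_X_pow, if_neg (by omega)]
        rw [mul_zero, add_zero, Nat.cast_one, one_mul, sub_neg_eq_add, AddChar.map_add_eq_mul]
        ring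
    have h0 : (1 - θ b) * ∑ g ∈ MF F N, lam θ μ 1 g = 0 := by linear_combination hshift
    rcases mul_eq_zero.mp h0 with h2 | h2
    · exact absurd (sub_eq_zero.mp h2).symm hb
    · exact h2

open scoped Classical in
lemma top_coeff (θ : AddChar F ℂ) (μ : MulChar F ℂ) {m : ℕ} (hm0 : 0 < m) (hmF : (m : F) ≠ 0) :
    ∑ g ∈ MF F m, lam θ μ m g = (∑ h ∈ (MF F m).filter (fun h => h.coeff 0 = 0), θ (pw m h)) *
      (μ ((-1) ^ m) * (μ (-(m : F)))⁻¹ * gaussSum μ θ) := by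
  have h1 : ∑ g ∈ MF F m, lam θ μ m g =
      ∑ y ∈ ((MF F m).filter (fun h => h.coeff 0 = 0)) ×ˢ (univ : Finset F),
        θ (pw m y.1) * (μ ((-1) ^ m * y.2) * θ (-(m : F) * y.2)) := by
    symm
    have hadd : ∀ h : F[X], h ∈ MF F m → ∀ c : F, h + C c ∈ MF F m := by
      intro h hh c
      rw [mem_MF] at hh
      simpa using monic_shift hh.1 hh.2 hm0 le_rfl c
    refine sum_bij' (fun y _ => y.1 + C y.2) (fun g _ => (g + C (-g.coeff 0), g.coeff 0))
      ?_ ?_ ?_ ?_ ?_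
    · rintro ⟨h, c⟩ hy
      simp only [mem_product, mem_filter] at hy
      exact hadd h hy.1.1 c
    · intro g hg
      simp only [mem_product, mem_filter, mem_univ, and_true]
      exact ⟨hadd g hg _, by simp⟩
    · rintro ⟨h, c⟩ hy
      simp only [mem_product, mem_filter] at hy
      simp [hy.1.2]
    · intro g hg
      simp
    · rintro ⟨h, c⟩ hy
      simp only [mem_product, mem_filter] at hy
      have h2 := hadd h hy.1.1 c
      have h3 := hy.1.1
      rw [mem_MF] at h2 h3
      have h4 := pw_add h3.1 h3.2 hm0 le_rfl c (by simpa using h2.1) (by simpa using h2.2)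
      simp only [Nat.sub_self, pow_zero, mul_one] at h4
      simp only
      rw [lam, h4, nn, h2.2, coeff_add, hy.1.2, coeff_C_zero, zero_add, sub_eq_add_neg,
        AddChar.map_add_eq_mul, neg_mul]
      ring
  rw [h1, sum_product, sum_mul]
  apply sum_congr rfl
  intro h _
  dsimp only
  rw [← mul_sum]
  congr 1
  have hu : (-(m : F)) ≠ 0 := neg_ne_zero.mpr hmF
  have h5 := gaussSum_mulShift μ θ (Units.mk0 _ hu)
  rw [← h5, Units.val_mk0, mul_assoc, ← mul_assoc (μ _)⁻¹, inv_mul_cancel₀, one_mul, gaussSum,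
    mul_sum]
  · apply sum_congr rfl
    intro c _
    rw [map_mul, AddChar.mulShift_apply]; ring
  · exact (IsUnit.map μ hu.isUnit).ne_zero

theorem main {p r m : ℕ} (hp : p.Prime) (hm0 : 0 < m)
    (hcard : Fintype.card F = p ^ r) (hqm : p ^ r ≡ 1 [MOD m])
    (θ : AddChar F ℂ) (hθ : θ ≠ 1) (s : Finset (MulChar F ℂ)) (hs : ∀ χ, χ ∈ s ↔ χ ^ m = 1) :
    ∃ D : ℂ, ∀ ψ : MulChar F ℂ, ∏ χ ∈ s, gaussSum (χ * ψ) θ =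
      D * (gaussSum (ψ ^ m) θ * ψ (((m : F) ^ m)⁻¹)) := by
  classical
  have hm : m ∣ Fintype.card F - 1 := by
    rw [hcard]
    exact (Nat.modEq_iff_dvd' (Nat.one_le_pow _ _ hp.pos)).mp hqm.symm
  have hmF : (m : F) ≠ 0 := by
    intro h0
    obtain ⟨c, hc⟩ := hm
    have h1 : Fintype.card F = m * c + 1 := by
      have := Fintype.card_pos (α := F); omega
    have h2 := congrArg (Nat.cast : ℕ → F) h1
    rw [FiniteField.cast_card_eq_zero] at h2
    simp [h0] at h2
  obtain ⟨p', hp'⟩ := CharP.exists F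
  have : Fact p'.Prime := ⟨CharP.char_is_prime F p'⟩
  let K : ℕ → Type := fun k => FiniteField.Extension F p' (k + 1)
  letI i1 : ∀ k, Field (K k) := fun k =>
    inferInstanceAs (Field (FiniteField.Extension F p' (k + 1)))
  letI i2 : ∀ k, Algebra F (K k) := fun k =>
    inferInstanceAs (Algebra F (FiniteField.Extension F p' (k + 1)))
  haveI i3 : ∀ k, Finite (K k) := fun k =>
    inferInstanceAs (Finite (FiniteField.Extension F p' (k + 1)))
  letI i4 : ∀ k, Fintype (K k) := fun k => Fintype.ofFinite _
  have hK : ∀ k, Module.finrank F (K k) = k + 1 := fun k =>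
    FiniteField.finrank_extension F p' (k + 1)
  refine ⟨∑ h ∈ (MF F m).filter (fun h => h.coeff 0 = 0), θ (pw m h), fun ψ => ?_⟩
  have key : Ls θ (ψ ^ m) m = ∏ χ ∈ s, Ls θ (χ * ψ) 1 := by
    apply deriv_unique (Ls_deriv K hK θ (ψ ^ m) hm0.ne') _ (Ls_const _ _ _)
    · rw [map_prod]
      exact prod_eq_one fun χ _ => Ls_const _ _ _
    · rw [prod_deriv s _ _ (fun χ _ => Ls_deriv K hK θ (χ * ψ) one_ne_zero)]
      congr 1
      ext k
      rw [map_sum, PowerSeries.coeff_mk, sum_lemma hm0 hm s hs]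
      simp only [PowerSeries.coeff_mk]
  rw [prod_congr rfl (fun χ _ => Ls_one θ hθ (χ * ψ))] at key
  have k2 := congrArg (PowerSeries.coeff m) key
  conv_rhs at k2 => rw [← card_chars hm s hs]
  rw [coeff_prod_lin, Ls, PowerSeries.coeff_mk, top_coeff θ _ hm0 hmF] at k2
  rw [← k2]
  congr 1
  rw [mul_comm (gaussSum _ _)]
  congr 1
  have hu : (-(m : F)) ≠ 0 := neg_ne_zero.mpr hmF
  have hne : (ψ ^ m) (-(m : F)) ≠ 0 := (IsUnit.map (ψ ^ m) hu.isUnit).ne_zero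
  rw [mul_inv_eq_iff_eq_mul₀ hne, MulChar.pow_apply' _ hm0.ne', MulChar.pow_apply' _ hm0.ne',
    ← map_pow, ← map_pow, ← map_mul, ← pow_mul, neg_pow (m : F) m]
  congr 1
  have hmm : (m : F) ^ m ≠ 0 := pow_ne_zero _ hmF
  field_simp
  rcases Nat.even_or_odd m with he | ho
  · rw [he.neg_one_pow, (he.mul_right m).neg_one_pow]
  · rw [ho.neg_one_pow, (ho.mul ho).neg_one_pow]

end final
end DH

open scoped Classical in
/-- Davenport–Hasse relation: if `q ≡ 1 (mod m)`, then for every multiplicative character `ψ`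
of `F_q`, `∏_{χ^m = ε} G(χψ) = -G(ψ^m) · ψ(m^{-m}) · ∏_{χ^m = ε} G(χ)`. -/
theorem davenport_hasse_relation
    {p r m : ℕ} (hp : p.Prime) (hr : 0 < r) (hm : 0 < m)
    {F : Type} [Field F] [Fintype F] [DecidableEq F]
    (hcard : Fintype.card F = p ^ r)
    (hqm : p ^ r ≡ 1 [MOD m])
    [Fintype (MulChar F ℂ)]
    (θ : AddChar F ℂ) (hθ : θ ≠ 1)
    (ψ : MulChar F ℂ) :
    ∏ χ ∈ univ.filter (fun χ : MulChar F ℂ => χ ^ m = 1), gaussSum (χ * ψ) θ =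
      -gaussSum (ψ ^ m) θ * ψ (((m : F) ^ m)⁻¹) *
        ∏ χ ∈ univ.filter (fun χ : MulChar F ℂ => χ ^ m = 1), gaussSum χ θ := by
  obtain ⟨D, hD⟩ := DH.main hp hm hcard hqm θ hθ
    (univ.filter (fun χ : MulChar F ℂ => χ ^ m = 1)) (by simp)
  have hmF : (m : F) ≠ 0 := by
    intro h0
    have hd : m ∣ p ^ r - 1 := (Nat.modEq_iff_dvd' (Nat.one_le_pow _ _ hp.pos)).mp hqm.symm
    obtain ⟨c, hc⟩ := hd
    have h1 : Fintype.card F = m * c + 1 := by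
      have := Fintype.card_pos (α := F); omega
    have h2 := congrArg (Nat.cast : ℕ → F) h1
    rw [FiniteField.cast_card_eq_zero] at h2
    simp [h0] at h2
  have h1 := hD 1
  rw [one_pow, gaussSum_one_left hθ,
    MulChar.one_apply (inv_ne_zero (pow_ne_zero _ hmF)).isUnit] at h1
  simp only [mul_one] at h1
  rw [hD ψ, h1]
  ring
end
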